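/- arXiv:math/0604322 — 2 statements merged into one kernel-verified Lean document; each statement's English description precedes it below -/
import Mathlib

section
/- Let x, y ∈ S_n with x ≤ y in the Bruhat order, and suppose the interval [x,y] = {z : x ≤ z ≤ y} is order-isomorphic to B(w_0^{(k)}), the principal Bruhat order ideal of the decreasing permutation w_0^{(k)} = k(k−1)···21 in S_k. Then there exist reduced decompositions i of x and j of y such that i is obtained from j by deleting a consecutive factor of j which is the shift by some M of an element of R(w_0^{(k)}). -/
namespace Paper

/-! ### Type A: the symmetric group `S_n` as `Equiv.Perm (Fin n)` -/

/-- The simple transposition `s_i ∈ S_n` (1-indexed letter `i`, meaningful for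
`1 ≤ i ≤ n-1`): it interchanges the entries in (1-indexed) positions `i` and `i+1`,
i.e. (0-indexed) positions `i-1` and `i` of `Fin n`. Out-of-range letters give `1`. -/
def sA (n : ℕ) (i : ℕ) : Equiv.Perm (Fin n) :=
  if h : 1 ≤ i ∧ i < n then Equiv.swap ⟨i - 1, by omega⟩ ⟨i, h.2⟩ else 1

/-- The product `s_{i_1} ⋯ s_{i_ℓ}` of a word `i_1 ⋯ i_ℓ`. -/
def prodA (n : ℕ) (w : List ℕ) : Equiv.Perm (Fin n) := (w.map (sA n)).prod

/-- A word in the letters `{1, …, n-1}`. -/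
def IsWordA (n : ℕ) (w : List ℕ) : Prop := ∀ i ∈ w, 1 ≤ i ∧ i ≤ n - 1

/-- `w` is a reduced decomposition of `x ∈ S_n`. -/
def ReducedA (n : ℕ) (w : List ℕ) (x : Equiv.Perm (Fin n)) : Prop :=
  IsWordA n w ∧ prodA n w = x ∧
    ∀ w' : List ℕ, IsWordA n w' → prodA n w' = x → w.length ≤ w'.length

/-- The Coxeter length `ℓ(x)`: minimal length of a word for `x`. -/
noncomputable def lenA (n : ℕ) (x : Equiv.Perm (Fin n)) : ℕ :=
  sInf {l | ∃ w : List ℕ, IsWordA n w ∧ prodA n w = x ∧ w.length = l}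

/-- Bruhat order on `S_n`: `v ≤ w` iff some reduced decomposition of `v` is a
(not necessarily consecutive) subword of some reduced decomposition of `w`. -/
def bruhatA (n : ℕ) (v w : Equiv.Perm (Fin n)) : Prop :=
  ∃ a b : List ℕ, ReducedA n a v ∧ ReducedA n b w ∧ a.Sublist b

/-- `w ∈ S_n` is boolean: the principal order ideal `B(w)`, ordered by the Bruhat
order, is order-isomorphic to the lattice of all subsets of `{1,…,r}` for some `r`. -/
def BooleanA (n : ℕ) (w : Equiv.Perm (Fin n)) : Prop :=
  ∃ (r : ℕ) (e : {v : Equiv.Perm (Fin n) // bruhatA n v w} ≃ Finset (Fin r)),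
    ∀ a b : {v : Equiv.Perm (Fin n) // bruhatA n v w}, bruhatA n a.1 b.1 ↔ e a ⊆ e b

/-- Pattern containment: `w ∈ S_n` contains `p ∈ S_k`. -/
def ContainsA {n k : ℕ} (w : Equiv.Perm (Fin n)) (p : Equiv.Perm (Fin k)) : Prop :=
  ∃ f : Fin k → Fin n, StrictMono f ∧ ∀ a b : Fin k, w (f a) < w (f b) ↔ p a < p b

/-- Pattern avoidance. -/
def AvoidsA {n k : ℕ} (w : Equiv.Perm (Fin n)) (p : Equiv.Perm (Fin k)) : Prop :=
  ¬ ContainsA w p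

/-- The pattern `321` (one-line notation). -/
def p321 : Equiv.Perm (Fin 3) := ⟨![2,1,0], ![2,1,0], by decide, by decide⟩
/-- The pattern `231` (one-line notation). -/
def p231 : Equiv.Perm (Fin 3) := ⟨![1,2,0], ![2,0,1], by decide, by decide⟩
/-- The pattern `312` (one-line notation). -/
def p312 : Equiv.Perm (Fin 3) := ⟨![2,0,1], ![1,2,0], by decide, by decide⟩
/-- The pattern `3412` (one-line notation). -/
def p3412 : Equiv.Perm (Fin 4) := ⟨![2,3,0,1], ![2,3,0,1], by decide, by decide⟩

/-- The longest (decreasing) permutation `w_0^{(k)} = k (k-1) ⋯ 2 1 ∈ S_k`. -/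
def w0 (k : ℕ) : Equiv.Perm (Fin k) := Fin.revPerm

/-- The shift of a word by `M`: each letter `i` becomes `i + M`. -/
def shift (M : ℕ) (w : List ℕ) : List ℕ := w.map (· + M)




/-! ### Types B and D: signed permutations, modelled as permutations `w` of `ℤ`
with `w(-x) = -w(x)` that fix all integers of absolute value `> n`. -/

/-- The simple generators of `S_n^B`, as permutations of `ℤ`:
`sB 0` negates the value `1`; for `i ≥ 1`, `sB i` interchanges the values
`i` and `i+1` (and `-i` and `-(i+1)`). -/
def sB : ℕ → Equiv.Perm ℤ
  | 0 => Equiv.swap 1 (-1)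
  | (i+1) => Equiv.swap ((i : ℤ) + 1) ((i : ℤ) + 2) * Equiv.swap (-((i : ℤ) + 1)) (-((i : ℤ) + 2))

/-- The simple generators of `S_n^D`: letter `0` encodes `s_{1'} = s_0 s_1 s_0`
(mapping `1 ↦ -2` and `2 ↦ -1`), and letters `i ≥ 1` are as in type `B`. -/
def sD : ℕ → Equiv.Perm ℤ
  | 0 => sB 0 * sB 1 * sB 0
  | (i+1) => sB (i+1)

def prodB (w : List ℕ) : Equiv.Perm ℤ := (w.map sB).prod
def prodD (w : List ℕ) : Equiv.Perm ℤ := (w.map sD).prod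

/-- A word in the type `B`/`D` letters `{0, 1, …, n-1}`. -/
def IsWordBD (n : ℕ) (w : List ℕ) : Prop := ∀ i ∈ w, i ≤ n - 1

/-- `w` is a reduced decomposition of `x ∈ S_n^B`. -/
def ReducedB (n : ℕ) (w : List ℕ) (x : Equiv.Perm ℤ) : Prop :=
  IsWordBD n w ∧ prodB w = x ∧
    ∀ w' : List ℕ, IsWordBD n w' → prodB w' = x → w.length ≤ w'.length

/-- `w` is a reduced decomposition of `x ∈ S_n^D`. -/
def ReducedD (n : ℕ) (w : List ℕ) (x : Equiv.Perm ℤ) : Prop :=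
  IsWordBD n w ∧ prodD w = x ∧
    ∀ w' : List ℕ, IsWordBD n w' → prodD w' = x → w.length ≤ w'.length

/-- Length in `S_n^B`. -/
noncomputable def lenB (n : ℕ) (x : Equiv.Perm ℤ) : ℕ :=
  sInf {l | ∃ w : List ℕ, IsWordBD n w ∧ prodB w = x ∧ w.length = l}

/-- Length in `S_n^D`. -/
noncomputable def lenD (n : ℕ) (x : Equiv.Perm ℤ) : ℕ :=
  sInf {l | ∃ w : List ℕ, IsWordBD n w ∧ prodD w = x ∧ w.length = l}

/-- Bruhat order on `S_n^B`. -/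
def bruhatB (n : ℕ) (v w : Equiv.Perm ℤ) : Prop :=
  ∃ a b : List ℕ, ReducedB n a v ∧ ReducedB n b w ∧ a.Sublist b

/-- Bruhat order on `S_n^D`. -/
def bruhatD (n : ℕ) (v w : Equiv.Perm ℤ) : Prop :=
  ∃ a b : List ℕ, ReducedD n a v ∧ ReducedD n b w ∧ a.Sublist b

/-- `w` is an element of `S_n^B`: an "odd" permutation of `{±1, …, ±n}`. -/
def IsSignedPerm (n : ℕ) (w : Equiv.Perm ℤ) : Prop :=
  (∀ x : ℤ, w (-x) = - w x) ∧ ∀ x : ℤ, (n : ℤ) < |x| → w x = x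

/-- `w` is an element of `S_n^D`: a signed permutation with an even number of
negative values in its one-line notation. -/
def IsTypeD (n : ℕ) (w : Equiv.Perm ℤ) : Prop :=
  IsSignedPerm n w ∧ Even (((Finset.Icc (1 : ℤ) n).filter (fun x => w x < 0)).card)

/-- `w ∈ S_n^B` is boolean (for the type `B` Bruhat order). -/
def BooleanB (n : ℕ) (w : Equiv.Perm ℤ) : Prop :=
  ∃ (r : ℕ) (e : {v : Equiv.Perm ℤ // bruhatB n v w} ≃ Finset (Fin r)),
    ∀ a b : {v : Equiv.Perm ℤ // bruhatB n v w}, bruhatB n a.1 b.1 ↔ e a ⊆ e b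

/-- `w ∈ S_n^D` is boolean (for the type `D` Bruhat order). -/
def BooleanD (n : ℕ) (w : Equiv.Perm ℤ) : Prop :=
  ∃ (r : ℕ) (e : {v : Equiv.Perm ℤ // bruhatD n v w} ≃ Finset (Fin r)),
    ∀ a b : {v : Equiv.Perm ℤ // bruhatD n v w}, bruhatD n a.1 b.1 ↔ e a ⊆ e b

/-- Signed pattern containment, where the pattern is given by its one-line
notation `p` (a list of nonzero integers): there are positions
`1 ≤ f 0 < ⋯ < f (k-1) ≤ n` such that each `w (f j)` has the same sign as the
`j`-th entry of `p`, and the absolute values appear in the same relative order. -/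
def containsPat (n : ℕ) (w : Equiv.Perm ℤ) (p : List ℤ) : Prop :=
  ∃ f : Fin p.length → ℤ, StrictMono f ∧ (∀ j, 1 ≤ f j ∧ f j ≤ (n : ℤ)) ∧
    (∀ j, 0 < w (f j) ↔ 0 < p.get j) ∧
    (∀ j j', |w (f j)| < |w (f j')| ↔ |p.get j| < |p.get j'|)

/-- Signed pattern avoidance. -/
def avoidsPat (n : ℕ) (w : Equiv.Perm ℤ) (p : List ℤ) : Prop := ¬ containsPat n w p


/-! ### Extra definitions used in some statements -/

/-- `w ∈ S_n` is decomposable: `B(w) ≅ B(u) × B(v)` (as posets under Bruhat order)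
for some `u ∈ S_m`, `v ∈ S_{m'}` with `m, m' < n`. -/
def Decomposable (n : ℕ) (w : Equiv.Perm (Fin n)) : Prop :=
  ∃ (m m' : ℕ), m < n ∧ m' < n ∧
    ∃ (u : Equiv.Perm (Fin m)) (v : Equiv.Perm (Fin m'))
      (e : {x : Equiv.Perm (Fin n) // bruhatA n x w} ≃
        {y : Equiv.Perm (Fin m) // bruhatA m y u} × {z : Equiv.Perm (Fin m') // bruhatA m' z v}),
      ∀ a b : {x : Equiv.Perm (Fin n) // bruhatA n x w},
        bruhatA n a.1 b.1 ↔
          (bruhatA m ((e a).1).1 ((e b).1).1 ∧ bruhatA m' ((e a).2).1 ((e b).2).1)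

/-- `w` is decreasing on the set of positions `T`. -/
def DecrOn (n : ℕ) (w : Equiv.Perm (Fin n)) (T : Finset (Fin n)) : Prop :=
  ∀ a ∈ T, ∀ b ∈ T, a < b → w b < w a

/-- Every inversion of `w` lies in exactly one occurrence of the decreasing
pattern `w_0^{(k)}`: for every `i < j` with `w i > w j` there is exactly one
`k`-element set of positions containing `i` and `j` on which `w` is decreasing. -/
def EveryInvOnce (n k : ℕ) (w : Equiv.Perm (Fin n)) : Prop :=
  ∀ i j : Fin n, i < j → w j < w i →
    ∃! T : Finset (Fin n), T.card = k ∧ DecrOn n w T ∧ i ∈ T ∧ j ∈ T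

/-- Equality of two patterns of (possibly a priori different) sizes. -/
def EqPat {k m : ℕ} (p : Equiv.Perm (Fin k)) (q : Equiv.Perm (Fin m)) : Prop :=
  ∃ h : k = m, ∀ i : Fin k, ((p i : ℕ) = (q (Fin.cast h i) : ℕ))

/-- `L(n,k)`: the number of boolean permutations in `S_n` of length `k`. -/
noncomputable def LA (n k : ℕ) : ℕ :=
  Nat.card {w : Equiv.Perm (Fin n) // BooleanA n w ∧ lenA n w = k}

/-- `L` extended to integer arguments, with the convention that it vanishes
when `m < 1` or `j < 0`. -/
noncomputable def Lz (m j : ℤ) : ℤ :=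
  if 1 ≤ m ∧ 0 ≤ j then (LA m.toNat j.toNat : ℤ) else 0

/-- `L^D(n,k)`: the number of boolean elements of `S_n^D` of length `k`. -/
noncomputable def LD (n k : ℕ) : ℕ :=
  Nat.card {w : Equiv.Perm ℤ // IsTypeD n w ∧ BooleanD n w ∧ lenD n w = k}

def Edge {n : ℕ} (u v : Equiv.Perm (Fin n)) : Prop :=
  ∃ p q : Fin n, p < q ∧ u p < u q ∧ v = u * Equiv.swap p q

def GLE {n : ℕ} (u v : Equiv.Perm (Fin n)) : Prop := Relation.ReflTransGen Edge u v

lemma swap_adj_lt {n : ℕ} {a b p q : Fin n} (hab : b.val = a.val + 1) (hpq : p < q)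
    (hne : ¬ (p = a ∧ q = b)) : Equiv.swap a b p < Equiv.swap a b q := by
  simp only [Equiv.swap_apply_def]
  simp only [Fin.lt_def, Fin.ext_iff] at *
  split_ifs <;> omega

lemma sA_eq {n i : ℕ} (h1 : 1 ≤ i) (h2 : i < n) :
    sA n i = Equiv.swap ⟨i - 1, by omega⟩ ⟨i, h2⟩ := by
  simp [sA, h1, h2]

lemma sA_mul_self (n i : ℕ) : sA n i * sA n i = 1 := by
  unfold sA
  split_ifs <;> simp

lemma prodA_append (n : ℕ) (a b : List ℕ) : prodA n (a ++ b) = prodA n a * prodA n b := by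
  simp [prodA]

lemma prodA_nil (n : ℕ) : prodA n [] = 1 := rfl

lemma prodA_singleton (n i : ℕ) : prodA n [i] = sA n i := by simp [prodA]

lemma isWordA_append {n : ℕ} {a b : List ℕ} :
    IsWordA n (a ++ b) ↔ IsWordA n a ∧ IsWordA n b := by
  simp only [IsWordA, List.mem_append]
  constructor
  · intro h; exact ⟨fun i hi => h i (Or.inl hi), fun i hi => h i (Or.inr hi)⟩
  · rintro ⟨h1, h2⟩ i (hi | hi)
    · exact h1 i hi
    · exact h2 i hi

lemma isWordA_singleton {n i : ℕ} : IsWordA n [i] ↔ 1 ≤ i ∧ i < n := by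
  simp only [IsWordA, List.mem_singleton, forall_eq]
  omega

lemma IsWordA.sublist {n : ℕ} {a b : List ℕ} (hb : IsWordA n b) (h : a.Sublist b) :
    IsWordA n a := fun i hi => hb i (h.subset hi)

lemma exists_word (n : ℕ) (x : Equiv.Perm (Fin n)) : ∃ w, IsWordA n w ∧ prodA n w = x := by
  cases n with
  | zero => exact ⟨[], by simp [IsWordA], Subsingleton.elim _ _⟩
  | succ m =>
    have hx : x ∈ Submonoid.closure
        (Set.range fun i : Fin m ↦ Equiv.swap i.castSucc i.succ) := by
      rw [Equiv.Perm.mclosure_swap_castSucc_succ]; trivial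
    induction hx using Submonoid.closure_induction with
    | mem x hx =>
      obtain ⟨i, rfl⟩ := hx
      refine ⟨[i.val + 1], isWordA_singleton.2 (by omega), ?_⟩
      rw [prodA_singleton, sA_eq (by omega) (by omega)]
      congr 1
    | one => exact ⟨[], by simp [IsWordA], rfl⟩
    | mul x y _ _ hx hy =>
      obtain ⟨a, ha, rfl⟩ := hx
      obtain ⟨b, hb, rfl⟩ := hy
      exact ⟨a ++ b, isWordA_append.2 ⟨ha, hb⟩, prodA_append _ _ _⟩

lemma lenA_le {n : ℕ} {w : List ℕ} (hw : IsWordA n w) : lenA n (prodA n w) ≤ w.length :=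
  Nat.sInf_le ⟨w, hw, rfl, rfl⟩

lemma exists_reduced' (n : ℕ) (x : Equiv.Perm (Fin n)) :
    ∃ w, IsWordA n w ∧ prodA n w = x ∧ w.length = lenA n x := by
  have : {l | ∃ w : List ℕ, IsWordA n w ∧ prodA n w = x ∧ w.length = l}.Nonempty := by
    obtain ⟨w, h1, h2⟩ := exists_word n x
    exact ⟨w.length, w, h1, h2, rfl⟩
  exact Nat.sInf_mem this

lemma reducedA_iff {n : ℕ} {w : List ℕ} {x : Equiv.Perm (Fin n)} :
    ReducedA n w x ↔ IsWordA n w ∧ prodA n w = x ∧ w.length = lenA n x := by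
  constructor
  · rintro ⟨h1, h2, h3⟩
    refine ⟨h1, h2, le_antisymm ?_ ?_⟩
    · obtain ⟨v, a, b, c⟩ := exists_reduced' n x
      rw [← c]; exact h3 v a b
    · rw [← h2]; exact lenA_le h1
  · rintro ⟨h1, h2, h3⟩
    refine ⟨h1, h2, ?_⟩
    intro w' a b
    rw [h3, ← b]; exact lenA_le a

lemma exists_reduced (n : ℕ) (x : Equiv.Perm (Fin n)) : ∃ w, ReducedA n w x := by
  obtain ⟨w, h⟩ := exists_reduced' n x
  exact ⟨w, reducedA_iff.2 h⟩

/-- Strong exchange. -/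
lemma strong_exchange {n : ℕ} (w : List ℕ) (hw : IsWordA n w) (p q : Fin n) (hpq : p < q)
    (h : prodA n w q < prodA n w p) :
    ∃ w' : List ℕ, w'.Sublist w ∧ w'.length + 1 = w.length ∧
      prodA n w' = prodA n w * Equiv.swap p q := by
  induction w using List.reverseRecOn generalizing p q with
  | nil => simp [prodA_nil] at h; exact absurd h (not_lt.2 hpq.le)
  | append_singleton w i ih =>
    obtain ⟨hw1, hw2⟩ := isWordA_append.1 hw
    rw [isWordA_singleton] at hw2
    rw [prodA_append, prodA_singleton] at h ⊢
    have hs := sA_eq hw2.1 hw2.2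
    by_cases hc : p = ⟨i - 1, by omega⟩ ∧ q = ⟨i, hw2.2⟩
    · refine ⟨w, by simp, by simp, ?_⟩
      rw [hs, hc.1, hc.2, mul_assoc, Equiv.swap_mul_self, mul_one]
    · have hlt : sA n i p < sA n i q := by
        rw [hs]; exact swap_adj_lt (by simp; omega) hpq hc
      obtain ⟨w', h1, h2, h3⟩ := ih hw1 _ _ hlt (by simpa using h)
      refine ⟨w' ++ [i], h1.append_right _, by simp; omega, ?_⟩
      rw [prodA_append, prodA_singleton, h3, mul_assoc, mul_assoc,
        Equiv.swap_apply_apply]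
      congr 1
      simp [mul_assoc]

lemma Edge.lenA_lt {n : ℕ} {u v : Equiv.Perm (Fin n)} (h : Edge u v) : lenA n u < lenA n v := by
  obtain ⟨p, q, hpq, h1, rfl⟩ := h
  obtain ⟨w, a, b, c⟩ := exists_reduced' n (u * Equiv.swap p q)
  obtain ⟨w', d, e, f⟩ := strong_exchange w a p q hpq (by rw [b]; simpa using h1)
  rw [b, mul_assoc, Equiv.swap_mul_self, mul_one] at f
  have := lenA_le (a.sublist d)
  rw [f] at this
  omega

lemma GLE.lenA_le {n : ℕ} {u v : Equiv.Perm (Fin n)} (h : GLE u v) : lenA n u ≤ lenA n v := by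
  induction h with
  | refl => exact le_rfl
  | tail _ h ih => exact ih.trans h.lenA_lt.le

lemma GLE.lenA_lt {n : ℕ} {u v : Equiv.Perm (Fin n)} (h : GLE u v) (hne : u ≠ v) :
    lenA n u < lenA n v := by
  rcases Relation.ReflTransGen.cases_tail h with h | ⟨c, h1, h2⟩
  · exact absurd h.symm hne
  · exact lt_of_le_of_lt (GLE.lenA_le h1) h2.lenA_lt

lemma GLE.antisymm {n : ℕ} {u v : Equiv.Perm (Fin n)} (h : GLE u v) (h' : GLE v u) : u = v := by
  by_contra hne
  exact absurd (h.lenA_lt hne) (not_lt.2 h'.lenA_le)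

lemma GLE.trans {n : ℕ} {u v w : Equiv.Perm (Fin n)} (h : GLE u v) (h' : GLE v w) : GLE u w :=
  Relation.ReflTransGen.trans h h'

lemma GLE.refl {n : ℕ} (u : Equiv.Perm (Fin n)) : GLE u u := Relation.ReflTransGen.refl

lemma Edge.gle {n : ℕ} {u v : Equiv.Perm (Fin n)} (h : Edge u v) : GLE u v :=
  Relation.ReflTransGen.single h

/-- an ascent at position `i` raises the length by one. -/
lemma lenA_mul_sA {n : ℕ} (u : Equiv.Perm (Fin n)) (i : ℕ) (h1 : 1 ≤ i) (h2 : i < n)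
    (h : u ⟨i - 1, by omega⟩ < u ⟨i, h2⟩) : lenA n (u * sA n i) = lenA n u + 1 := by
  have he : Edge u (u * sA n i) :=
    ⟨⟨i - 1, by omega⟩, ⟨i, h2⟩, by simp [Fin.lt_def]; omega, h, by rw [sA_eq h1 h2]⟩
  have := he.lenA_lt
  obtain ⟨w, a, b, c⟩ := exists_reduced' n u
  have h3 := lenA_le (n := n) (w := w ++ [i]) (isWordA_append.2 ⟨a, isWordA_singleton.2 ⟨h1, h2⟩⟩)
  rw [prodA_append, prodA_singleton, b] at h3
  simp at h3
  omega

lemma lenA_mul_sA' {n : ℕ} (u : Equiv.Perm (Fin n)) (i : ℕ) (h1 : 1 ≤ i) (h2 : i < n)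
    (h : u ⟨i, h2⟩ < u ⟨i - 1, by omega⟩) : lenA n (u * sA n i) + 1 = lenA n u := by
  have := lenA_mul_sA (u * sA n i) i h1 h2 (by simpa [sA_eq h1 h2] using h)
  rw [mul_assoc, sA_mul_self, mul_one] at this
  omega

lemma ascent_or_descent {n : ℕ} (u : Equiv.Perm (Fin n)) (i : ℕ) (h1 : 1 ≤ i) (h2 : i < n) :
    u ⟨i - 1, by omega⟩ < u ⟨i, h2⟩ ∨ u ⟨i, h2⟩ < u ⟨i - 1, by omega⟩ := by
  apply lt_or_gt_of_ne
  intro h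
  have := u.injective h
  simp [Fin.ext_iff] at this
  omega

/-- Deletion. -/
lemma exists_reduced_sublist {n : ℕ} (w : List ℕ) (hw : IsWordA n w) :
    ∃ w' : List ℕ, w'.Sublist w ∧ ReducedA n w' (prodA n w) := by
  induction w using List.reverseRecOn with
  | nil => exact ⟨[], List.Sublist.refl _, by simp [IsWordA], rfl, by simp⟩
  | append_singleton w i ih =>
    obtain ⟨hw1, hw2⟩ := isWordA_append.1 hw
    have hwi := isWordA_singleton.1 hw2
    obtain ⟨w', h1, h2⟩ := ih hw1
    obtain ⟨a, b, c⟩ := reducedA_iff.1 h2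
    rw [prodA_append, prodA_singleton]
    rcases ascent_or_descent (prodA n w) i hwi.1 hwi.2 with h | h
    · refine ⟨w' ++ [i], h1.append_right _, reducedA_iff.2
        ⟨isWordA_append.2 ⟨a, hw2⟩, by rw [prodA_append, prodA_singleton, b], ?_⟩⟩
      rw [lenA_mul_sA _ _ hwi.1 hwi.2 h]; simp [c]
    · obtain ⟨w'', d, e, f⟩ := strong_exchange w' a ⟨i - 1, by omega⟩ ⟨i, hwi.2⟩
        (by simp [Fin.lt_def]; omega) (by rw [b]; exact h)
      refine ⟨w'', (d.trans h1).trans (by simp), reducedA_iff.2 ⟨a.sublist d, ?_, ?_⟩⟩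
      · rw [f, b, sA_eq hwi.1 hwi.2]
      · have := lenA_mul_sA' _ _ hwi.1 hwi.2 h
        omega

lemma GLE.exists_sublist {n : ℕ} {u v : Equiv.Perm (Fin n)} (h : GLE u v) (w : List ℕ)
    (hw : IsWordA n w) (hv : prodA n w = v) : ∃ w', w'.Sublist w ∧ ReducedA n w' u := by
  suffices ∃ w', w'.Sublist w ∧ prodA n w' = u by
    obtain ⟨w', h1, h2⟩ := this
    obtain ⟨w'', h3, h4⟩ := exists_reduced_sublist w' (hw.sublist h1)
    exact ⟨w'', h3.trans h1, h2 ▸ h4⟩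
  induction h using Relation.ReflTransGen.head_induction_on with
  | refl => exact ⟨w, List.Sublist.refl _, hv⟩
  | head h _ ih =>
    obtain ⟨w', h1, h2⟩ := ih
    obtain ⟨p, q, hpq, h3, rfl⟩ := h
    obtain ⟨w'', d, e, f⟩ := strong_exchange w' (hw.sublist h1) p q hpq
      (by rw [h2]; simpa using h3)
    refine ⟨w'', d.trans h1, ?_⟩
    rw [f, h2, mul_assoc, Equiv.swap_mul_self, mul_one]

/-- Lifting. -/
lemma GLE.lift {n : ℕ} {u v : Equiv.Perm (Fin n)} (h : GLE u v) (i : ℕ) (h1 : 1 ≤ i)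
    (h2 : i < n) (hv : v ⟨i - 1, by omega⟩ < v ⟨i, h2⟩) : GLE (u * sA n i) (v * sA n i) := by
  have hs := sA_eq h1 h2
  induction h using Relation.ReflTransGen.head_induction_on with
  | refl => exact GLE.refl _
  | head h h' ih =>
    obtain ⟨p, q, hpq, h3, rfl⟩ := h
    by_cases hc : p = ⟨i - 1, by omega⟩ ∧ q = ⟨i, h2⟩
    · rw [hc.1, hc.2, ← hs] at h'
      rw [hc.1, hc.2] at hpq
      refine GLE.trans h' (Edge.gle ⟨_, _, hpq, hv, by rw [hs]⟩)
    · refine GLE.trans (Edge.gle ⟨sA n i p, sA n i q, ?_, ?_, ?_⟩) ih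
      · rw [hs]; exact swap_adj_lt (by simp; omega) hpq hc
      · simpa [hs] using h3
      · rw [Equiv.swap_apply_apply]
        simp only [mul_assoc]
        congr 1
        simp [hs]

lemma gle_of_sublist {n : ℕ} (b : List ℕ) (a : List ℕ) (hab : a.Sublist b)
    (hb : ReducedA n b (prodA n b)) : GLE (prodA n a) (prodA n b) := by
  induction b using List.reverseRecOn generalizing a with
  | nil => rw [List.sublist_nil.1 hab]; exact GLE.refl _
  | append_singleton b i ih =>
    obtain ⟨c, _, d⟩ := reducedA_iff.1 hb
    obtain ⟨hw1, hw2⟩ := isWordA_append.1 c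
    have hwi := isWordA_singleton.1 hw2
    rw [prodA_append, prodA_singleton] at d ⊢
    have hle := lenA_le hw1
    have hasc : prodA n b ⟨i - 1, by omega⟩ < prodA n b ⟨i, hwi.2⟩ := by
      rcases ascent_or_descent (prodA n b) i hwi.1 hwi.2 with h | h
      · exact h
      · have := lenA_mul_sA' _ _ hwi.1 hwi.2 h
        simp at d; omega
    have hlen := lenA_mul_sA _ _ hwi.1 hwi.2 hasc
    have hbr : ReducedA n b (prodA n b) := reducedA_iff.2 ⟨hw1, rfl, by simp at d; omega⟩
    obtain ⟨a1, a2, rfl, s1, s2⟩ := List.sublist_append_iff.1 hab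
    have h1 := ih a1 s1 hbr
    rw [prodA_append]
    rcases List.sublist_singleton.1 s2 with rfl | rfl
    · rw [prodA_nil, mul_one]
      exact h1.trans (Edge.gle ⟨_, _, by simp [Fin.lt_def]; omega, hasc, by rw [sA_eq hwi.1 hwi.2]⟩)
    · rw [prodA_singleton]
      exact h1.lift i hwi.1 hwi.2 hasc

lemma bruhatA_iff {n : ℕ} {u v : Equiv.Perm (Fin n)} : bruhatA n u v ↔ GLE u v := by
  constructor
  · rintro ⟨a, b, ha, hb, hab⟩
    have := gle_of_sublist b a hab (by rw [hb.2.1]; exact hb)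
    rwa [ha.2.1, hb.2.1] at this
  · intro h
    obtain ⟨b, hb⟩ := exists_reduced n v
    obtain ⟨a, h1, h2⟩ := h.exists_sublist b hb.1 hb.2.1
    exact ⟨a, b, h2, hb, h1⟩

lemma shift_append (M : ℕ) (a b : List ℕ) : shift M (a ++ b) = shift M a ++ shift M b := by
  simp [shift]

lemma sA_shift_apply {n k M : ℕ} (hM : M + k ≤ n) {i : ℕ} (h1 : 1 ≤ i) (h2 : i < k) (j : Fin k) :
    sA n (i + M) ⟨M + j.val, by omega⟩ = ⟨M + (sA k i j).val, by omega⟩ := by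
  simp only [sA_eq (n := n) (i := i + M) (by omega) (by omega), sA_eq h1 h2]
  simp only [Equiv.swap_apply_def, Fin.ext_iff]
  split_ifs <;> simp <;> omega

lemma sA_shift_apply' {n k M : ℕ} (hM : M + k ≤ n) {i : ℕ} (h1 : 1 ≤ i) (h2 : i < k) (q : Fin n)
    (hq : q.val < M ∨ M + k ≤ q.val) : sA n (i + M) q = q := by
  rw [sA_eq (by omega) (by omega)]
  simp only [Equiv.swap_apply_def, Fin.ext_iff]
  split_ifs <;> simp <;> omega

lemma prodA_shift_apply {n k M : ℕ} (hM : M + k ≤ n) (w : List ℕ) (hw : IsWordA k w) (j : Fin k) :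
    prodA n (shift M w) ⟨M + j.val, by omega⟩ = ⟨M + (prodA k w j).val, by omega⟩ := by
  induction w using List.reverseRecOn generalizing j with
  | nil => rfl
  | append_singleton w i ih =>
    obtain ⟨hw1, hw2⟩ := isWordA_append.1 hw
    have hwi := isWordA_singleton.1 hw2
    have e1 : shift M [i] = [i + M] := rfl
    simp only [shift_append, prodA_append, e1, prodA_singleton, Equiv.Perm.mul_apply,
      sA_shift_apply hM hwi.1 hwi.2, ih hw1]

lemma prodA_shift_apply' {n k M : ℕ} (hM : M + k ≤ n) (w : List ℕ) (hw : IsWordA k w) (q : Fin n)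
    (hq : q.val < M ∨ M + k ≤ q.val) : prodA n (shift M w) q = q := by
  induction w using List.reverseRecOn with
  | nil => rfl
  | append_singleton w i ih =>
    obtain ⟨hw1, hw2⟩ := isWordA_append.1 hw
    have hwi := isWordA_singleton.1 hw2
    rw [shift_append, prodA_append]
    have e1 : shift M [i] = [i + M] := rfl
    rw [e1, prodA_singleton, Equiv.Perm.mul_apply, sA_shift_apply' hM hwi.1 hwi.2 q hq, ih hw1]

lemma isWordA_shift {n k M : ℕ} (hM : M + k ≤ n) (w : List ℕ) (hw : IsWordA k w) :
    IsWordA n (shift M w) := by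
  intro i hi
  simp only [shift, List.mem_map] at hi
  obtain ⟨j, hj, rfl⟩ := hi
  have := hw j hj
  omega

lemma reduced_prefix {n i : ℕ} {b : List ℕ} (hb : ReducedA n (b ++ [i]) (prodA n (b ++ [i]))) :
    ∃ (h1 : 1 ≤ i) (h2 : i < n), ReducedA n b (prodA n b) ∧
      prodA n b ⟨i - 1, by omega⟩ < prodA n b ⟨i, h2⟩ := by
  obtain ⟨c, _, d⟩ := reducedA_iff.1 hb
  obtain ⟨hw1, hw2⟩ := isWordA_append.1 c
  have hwi := isWordA_singleton.1 hw2
  rw [prodA_append, prodA_singleton] at d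
  have hle := lenA_le hw1
  have hasc : prodA n b ⟨i - 1, by omega⟩ < prodA n b ⟨i, hwi.2⟩ := by
    rcases ascent_or_descent (prodA n b) i hwi.1 hwi.2 with h | h
    · exact h
    · have := lenA_mul_sA' _ _ hwi.1 hwi.2 h
      simp at d; omega
  have hlen := lenA_mul_sA _ _ hwi.1 hwi.2 hasc
  exact ⟨hwi.1, hwi.2, reducedA_iff.2 ⟨hw1, rfl, by simp at d; omega⟩, hasc⟩

lemma lenA_mul_shift {n k M : ℕ} (hM : M + k ≤ n) (x : Equiv.Perm (Fin n))
    (hx : ∀ i j : Fin k, i < j → x ⟨M + i.val, by omega⟩ < x ⟨M + j.val, by omega⟩)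
    (w : List ℕ) (hw : ReducedA k w (prodA k w)) :
    lenA n (x * prodA n (shift M w)) = lenA n x + w.length := by
  induction w using List.reverseRecOn with
  | nil => simp [shift, prodA_nil]
  | append_singleton w i ih =>
    obtain ⟨h1, h2, h3, h4⟩ := reduced_prefix hw
    have e1 : shift M [i] = [i + M] := rfl
    rw [shift_append, prodA_append, e1, prodA_singleton, ← mul_assoc,
      lenA_mul_sA _ _ (by omega) (by omega), ih h3]
    · simp; omega
    · have ea : (⟨i + M - 1, by omega⟩ : Fin n) = ⟨M + (⟨i - 1, by omega⟩ : Fin k).val, by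
        simp; omega⟩ := by simp [Fin.ext_iff]; omega
      have eb : (⟨i + M, by omega⟩ : Fin n) = ⟨M + (⟨i, h2⟩ : Fin k).val, by
        simp; omega⟩ := by simp [Fin.ext_iff]; omega
      rw [Equiv.Perm.mul_apply, Equiv.Perm.mul_apply, ea, eb, prodA_shift_apply hM w h3.1,
        prodA_shift_apply hM w h3.1]
      exact hx _ _ h4

lemma reduced_append_singleton {n i : ℕ} {a : List ℕ} {u : Equiv.Perm (Fin n)} (h1 : 1 ≤ i)
    (h2 : i < n) (h : u ⟨i, h2⟩ < u ⟨i - 1, by omega⟩) (ha : ReducedA n a (u * sA n i)) :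
    ReducedA n (a ++ [i]) u := by
  obtain ⟨c, d, e⟩ := reducedA_iff.1 ha
  refine reducedA_iff.2 ⟨isWordA_append.2 ⟨c, isWordA_singleton.2 ⟨h1, h2⟩⟩, ?_, ?_⟩
  · rw [prodA_append, prodA_singleton, d, mul_assoc, sA_mul_self, mul_one]
  · have := lenA_mul_sA' u i h1 h2 h
    simp; omega

lemma factor_contig {n m : ℕ} (m0 : List ℕ) (hm0 : ReducedA (m + 1) m0 (w0 (m + 1)))
    (x y : Equiv.Perm (Fin n)) (f : Fin (m + 1) → Fin n)
    (hx : ∀ i j, i < j → x (f i) < x (f j))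
    (hy : ∀ i, y (f i) = x (f i.rev)) (hy' : ∀ q, q ∉ Set.range f → y q = x q)
    (hc : ∀ i, (f i).val = (f 0).val + i.val) :
    ∃ (pre post : List ℕ) (M : ℕ), ReducedA n (pre ++ shift M m0 ++ post) y ∧
      ReducedA n (pre ++ post) x := by
  obtain ⟨pre, hpre⟩ := exists_reduced n x
  have hM : (f 0).val + (m + 1) ≤ n := by
    have := hc (Fin.last m)
    have := (f (Fin.last m)).isLt
    simp at *; omega
  have hf : ∀ i : Fin (m + 1), f i = ⟨(f 0).val + i.val, by omega⟩ := fun i => Fin.ext (hc i)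
  refine ⟨pre, [], (f 0).val, ?_, by simpa using hpre⟩
  rw [List.append_nil]
  have hyx : y = x * prodA n (shift (f 0).val m0) := by
    ext1 q
    rw [Equiv.Perm.mul_apply]
    by_cases hq : q ∈ Set.range f
    · obtain ⟨i, rfl⟩ := hq
      rw [hy, hf i, prodA_shift_apply hM m0 hm0.1, hf i.rev]
      simp only [hm0.2.1]
      rfl
    · rw [hy' q hq, prodA_shift_apply' hM m0 hm0.1]
      by_contra hcon
      push Not at hcon
      apply hq
      refine ⟨⟨q.val - (f 0).val, by omega⟩, ?_⟩
      rw [hf]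
      apply Fin.ext
      simp; omega
  obtain ⟨a, b, c⟩ := reducedA_iff.1 hpre
  refine reducedA_iff.2 ⟨isWordA_append.2 ⟨a, isWordA_shift hM _ hm0.1⟩, ?_, ?_⟩
  · rw [prodA_append, b, hyx]
  · rw [hyx, lenA_mul_shift hM x _ m0 (by rw [hm0.2.1]; exact hm0)]
    · simp [c, shift]
    · intro i j hij
      have := hx i j hij
      rwa [hf i, hf j] at this

lemma exists_descent {n m : ℕ} (x y : Equiv.Perm (Fin n)) (f : Fin (m + 1) → Fin n)
    (hf : StrictMono f) (hx : ∀ i j, i < j → x (f i) < x (f j))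
    (hy : ∀ i, y (f i) = x (f i.rev)) (hy' : ∀ q, q ∉ Set.range f → y q = x q)
    (hbox : ∀ q, q ∉ Set.range f → f 0 < q → q < f (Fin.last m) → x (f 0) < x q →
      x q < x (f (Fin.last m)) → False)
    (hnc : ¬ ∀ i, (f i).val = (f 0).val + i.val) :
    ∃ (i : ℕ) (h1 : 1 ≤ i) (h2 : i < n), (f 0).val ≤ i - 1 ∧ i ≤ (f (Fin.last m)).val ∧
      x ⟨i, h2⟩ < x ⟨i - 1, by omega⟩ ∧ y ⟨i, h2⟩ < y ⟨i - 1, by omega⟩ ∧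
      ¬ ((⟨i - 1, by omega⟩ : Fin n) ∈ Set.range f ∧ (⟨i, h2⟩ : Fin n) ∈ Set.range f) := by
  classical
  by_contra hcon
  push Not at hcon
  apply hnc
  have x0 : ∀ i, x (f 0) ≤ x (f i) := by
    intro i
    rcases eq_or_lt_of_le (Fin.zero_le i) with h | h
    · rw [← h]
    · exact (hx _ _ h).le
  have xl : ∀ i, x (f i) ≤ x (f (Fin.last m)) := by
    intro i
    rcases eq_or_lt_of_le (Fin.le_last i) with h | h
    · rw [← h]
    · exact (hx _ _ h).le
  let c : ℕ → ℕ := fun j => if h : j < n then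
    (if (⟨j, h⟩ : Fin n) ∈ Set.range f then 1 else if x ⟨j, h⟩ < x (f 0) then 0 else 2) else 0
  have hcr : ∀ j (h : j < n), (⟨j, h⟩ : Fin n) ∈ Set.range f ↔ c j = 1 := by
    intro j h
    simp only [c, h, dif_pos]
    split_ifs <;> simp_all
  have hc0 : ∀ j (h : j < n), (⟨j, h⟩ : Fin n) ∉ Set.range f → x ⟨j, h⟩ < x (f 0) → c j = 0 := by
    intro j h h1 h2
    simp only [c, h, dif_pos, if_neg h1, if_pos h2]
  have hc2 : ∀ j (h : j < n), (⟨j, h⟩ : Fin n) ∉ Set.range f → ¬ x ⟨j, h⟩ < x (f 0) → c j = 2 := by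
    intro j h h1 h2
    simp only [c, h, dif_pos, if_neg h1, if_neg h2]
  have hmono : ∀ j, (f 0).val ≤ j → j + 1 ≤ (f (Fin.last m)).val → c j ≤ c (j + 1) := by
    intro j hj0 hj1
    have hl := (f (Fin.last m)).isLt
    have hjn : j < n := by omega
    have hjn' : j + 1 < n := by omega
    by_contra hlt
    push Not at hlt
    have key := hcon (j + 1) (by omega) hjn' (by omega) hj1
    simp only [Nat.add_sub_cancel] at key
    have hbig : (⟨j, hjn⟩ : Fin n) ∉ Set.range f → ¬ x ⟨j, hjn⟩ < x (f 0) →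
        x (f (Fin.last m)) < x ⟨j, hjn⟩ := by
      intro h1 h2
      have n0 : (⟨j, hjn⟩ : Fin n) ≠ f 0 := fun h => h1 ⟨0, h.symm⟩
      have nl : (⟨j, hjn⟩ : Fin n) ≠ f (Fin.last m) := fun h => h1 ⟨_, h.symm⟩
      have nx0 : x ⟨j, hjn⟩ ≠ x (f 0) := fun h => n0 (x.injective h)
      have nxl : x ⟨j, hjn⟩ ≠ x (f (Fin.last m)) := fun h => nl (x.injective h)
      by_contra h3
      exact hbox _ h1 (lt_of_le_of_ne hj0 n0.symm) (lt_of_le_of_ne (by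
        simp [Fin.le_def]; omega) nl) (lt_of_le_of_ne (not_lt.1 h2) nx0.symm)
        (lt_of_le_of_ne (not_lt.1 h3) nxl)
    have hyb : ∀ i, x (f 0) ≤ y (f i) ∧ y (f i) ≤ x (f (Fin.last m)) := by
      intro i; rw [hy]; exact ⟨x0 _, xl _⟩
    by_cases hA : (⟨j, hjn⟩ : Fin n) ∈ Set.range f
    · have e1 := (hcr _ _).1 hA
      by_cases hB : (⟨j + 1, hjn'⟩ : Fin n) ∈ Set.range f
      · have := (hcr _ _).1 hB; omega
      · by_cases hB2 : x ⟨j + 1, hjn'⟩ < x (f 0)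
        · obtain ⟨i, hi⟩ := hA
          refine hB (key ?_ ?_).2
          · rw [← hi]; exact lt_of_lt_of_le hB2 (x0 i)
          · rw [← hi, hy' _ hB]; exact lt_of_lt_of_le hB2 (hyb i).1
        · have := hc2 _ _ hB hB2; omega
    · by_cases hA2 : x ⟨j, hjn⟩ < x (f 0)
      · have := hc0 _ _ hA hA2; omega
      · have hbg := hbig hA hA2
        apply hA
        by_cases hB : (⟨j + 1, hjn'⟩ : Fin n) ∈ Set.range f
        · obtain ⟨i, hi⟩ := hB
          refine (key ?_ ?_).1
          · rw [← hi]; exact lt_of_le_of_lt (xl i) hbg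
          · rw [← hi, hy' _ hA]; exact lt_of_le_of_lt (hyb i).2 hbg
        · by_cases hB2 : x ⟨j + 1, hjn'⟩ < x (f 0)
          · have := lt_of_lt_of_le hB2 (not_lt.1 hA2)
            refine (key this ?_).1
            rw [hy' _ hA, hy' _ hB]; exact this
          · have := hc2 _ _ hB hB2
            have := hc2 _ _ hA hA2
            omega
  have c0 : c (f 0).val = 1 := (hcr _ (f 0).isLt).1 ⟨0, rfl⟩
  have cl : c (f (Fin.last m)).val = 1 := (hcr _ (f (Fin.last m)).isLt).1 ⟨_, rfl⟩
  have hup : ∀ a b, a ≤ b → (f 0).val ≤ a → b ≤ (f (Fin.last m)).val → c a ≤ c b := by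
    intro a b hab
    induction b, hab using Nat.le_induction with
    | base => intros; exact le_rfl
    | succ b hb ih =>
      intro h1 h2
      exact (ih h1 (by omega)).trans (hmono b (by omega) h2)
  have hall : ∀ j : Fin n, f 0 ≤ j → j ≤ f (Fin.last m) → j ∈ Set.range f := by
    intro j h1 h2
    apply (hcr j.val j.isLt).2
    have e1 := hup (f 0).val j.val h1 le_rfl h2
    have e2 := hup j.val (f (Fin.last m)).val h2 h1 le_rfl
    omega
  intro i
  induction i using Fin.induction with
  | zero => simp
  | succ i ih =>
    have hlt : f i.castSucc < f i.succ := hf (Fin.castSucc_lt_succ)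
    have hle : f i.succ ≤ f (Fin.last m) := hf.monotone (Fin.le_last _)
    have hn := (f i.succ).isLt
    have h0 : f 0 ≤ f i.castSucc := hf.monotone (Fin.zero_le _)
    simp only [Fin.lt_def, Fin.le_def] at hlt hle h0
    obtain ⟨j, hj⟩ := hall ⟨(f i.castSucc).val + 1, by omega⟩
      (by simp only [Fin.le_def]; omega) (by simp only [Fin.le_def]; omega)
    have hj2 : f i.castSucc < f j := by rw [hj]; simp [Fin.lt_def]
    have hj3 := hf.lt_iff_lt.1 hj2
    have hj4 : i.succ ≤ j := Fin.castSucc_lt_iff_succ_le.1 hj3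
    have hj5 := hf.monotone hj4
    rw [hj] at hj5
    simp only [Fin.le_def] at hj5
    simp at ih ⊢
    omega

lemma factor {n m : ℕ} (m0 : List ℕ) (hm0 : ReducedA (m + 1) m0 (w0 (m + 1))) (l : ℕ) :
    ∀ (x y : Equiv.Perm (Fin n)) (f : Fin (m + 1) → Fin n) (_ : lenA n x = l)
    (_ : StrictMono f) (_ : ∀ i j, i < j → x (f i) < x (f j))
    (_ : ∀ i, y (f i) = x (f i.rev)) (_ : ∀ q, q ∉ Set.range f → y q = x q)
    (_ : ∀ q, q ∉ Set.range f → f 0 < q → q < f (Fin.last m) → x (f 0) < x q →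
      x q < x (f (Fin.last m)) → False),
    ∃ (pre post : List ℕ) (M : ℕ), ReducedA n (pre ++ shift M m0 ++ post) y ∧
      ReducedA n (pre ++ post) x := by
  induction l using Nat.strong_induction_on with
  | _ l ih =>
  intro x y f hl hf hx hy hy' hbox
  by_cases hc : ∀ i, (f i).val = (f 0).val + i.val
  · exact factor_contig m0 hm0 x y f hx hy hy' hc
  · obtain ⟨i, h1, h2, h0, hlast, hdx, hdy, hnb⟩ := exists_descent x y f hf hx hy hy' hbox hc
    have hlen := lenA_mul_sA' x i h1 h2 hdx
    have hs := sA_eq h1 h2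
    have hss : ∀ q, sA n i (sA n i q) = q := by intro q; simp [hs]
    have hmono : ∀ p q : Fin n, p < q → ¬ (p.val = i - 1 ∧ q.val = i) → sA n i p < sA n i q := by
      intro p q hpq hne
      rw [hs]
      apply swap_adj_lt (by simp; omega) hpq
      simpa [Fin.ext_iff] using hne
    have hsa : sA n i ⟨i - 1, by omega⟩ = ⟨i, h2⟩ := by simp [hs]
    have hsb : sA n i ⟨i, h2⟩ = ⟨i - 1, by omega⟩ := by simp [hs]
    have hrange : ∀ q, q ∉ Set.range (fun j => sA n i (f j)) → sA n i q ∉ Set.range f := by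
      rintro q hq ⟨j, hj⟩
      exact hq ⟨j, by simp only [hj, hss]⟩
    have key : ∃ (pre post : List ℕ) (M : ℕ), ReducedA n (pre ++ shift M m0 ++ post) (y * sA n i) ∧
        ReducedA n (pre ++ post) (x * sA n i) := by
      refine ih (lenA n (x * sA n i)) (by omega) (x * sA n i) (y * sA n i)
        (fun j => sA n i (f j)) rfl ?_ ?_ ?_ ?_ ?_
      · intro a b hab
        apply hmono _ _ (hf hab)
        rintro ⟨e1, e2⟩
        exact hnb ⟨⟨a, Fin.ext e1⟩, ⟨b, Fin.ext e2⟩⟩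
      · intro a b hab
        simpa [hss] using hx a b hab
      · intro a
        simpa [hss] using hy a
      · intro q hq
        simpa using hy' _ (hrange q hq)
      · intro q hq q1 q2 q3 q4
        simp only [Equiv.Perm.mul_apply, hss] at q3 q4
        refine hbox _ (hrange q hq) ?_ ?_ q3 q4
        · have := hmono _ _ q1 (by
            rintro ⟨e1, e2⟩
            have e3 : sA n i (f 0) = ⟨i - 1, by omega⟩ := Fin.ext e1
            have e4 := congrArg (sA n i) e3
            rw [hss, hsa] at e4
            rw [e4] at h0
            simp at h0
            omega)
          rwa [hss] at this
        · have := hmono _ _ q2 (by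
            rintro ⟨e1, e2⟩
            have e3 : sA n i (f (Fin.last m)) = ⟨i, h2⟩ := Fin.ext e2
            have e4 := congrArg (sA n i) e3
            rw [hss, hsb] at e4
            rw [e4] at hlast
            simp at hlast
            omega)
          rwa [hss] at this
    obtain ⟨pre, post, M, hA, hB⟩ := key
    refine ⟨pre, post ++ [i], M, ?_, ?_⟩
    · rw [← List.append_assoc]
      exact reduced_append_singleton h1 h2 hdy hA
    · rw [← List.append_assoc]
      exact reduced_append_singleton h1 h2 hdx hB

lemma box_edges {n : ℕ} (x : Equiv.Perm (Fin n)) (p r q : Fin n) (h1 : p < r) (h2 : r < q)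
    (h3 : x p < x r) (h4 : x r < x q) :
    (∃ z, Edge (x * Equiv.swap p r) z ∧ Edge z (x * Equiv.swap p q)) ∧
    (∃ z, Edge (x * Equiv.swap r q) z ∧ Edge z (x * Equiv.swap p q)) := by
  have n1 := h1.ne
  have n2 := h2.ne
  have n3 := (h1.trans h2).ne
  constructor
  · refine ⟨x * Equiv.swap p r * Equiv.swap p q, ⟨p, q, h1.trans h2, ?_, rfl⟩,
      ⟨r, q, h2, ?_, ?_⟩⟩
    · simp only [Equiv.Perm.mul_apply, Equiv.swap_apply_def]; grind
    · simp only [Equiv.Perm.mul_apply, Equiv.swap_apply_def]; grind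
    · ext1 z; simp only [Equiv.Perm.mul_apply, Equiv.swap_apply_def]; grind
  · refine ⟨x * Equiv.swap r q * Equiv.swap p q, ⟨p, q, h1.trans h2, ?_, rfl⟩,
      ⟨p, r, h1, ?_, ?_⟩⟩
    · simp only [Equiv.Perm.mul_apply, Equiv.swap_apply_def]; grind
    · simp only [Equiv.Perm.mul_apply, Equiv.swap_apply_def]; grind
    · ext1 z; simp only [Equiv.Perm.mul_apply, Equiv.swap_apply_def]; grind

def Dia {n : ℕ} (u : Equiv.Perm (Fin n)) (p q r s : Fin n) : Prop :=
  ∃ a b : Fin n, a < b ∧ u a < u b ∧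
    Edge (u * Equiv.swap a b) (u * Equiv.swap p q * Equiv.swap r s) ∧
    (Equiv.swap r s = Equiv.swap a b ∨
      Equiv.swap r s = Equiv.swap p q * Equiv.swap a b * Equiv.swap p q)

lemma dia_core {n : ℕ} (u : Equiv.Perm (Fin n)) (p q r s a b c d : Fin n) (h1 : a < b)
    (h2 : u a < u b) (h3 : c < d) (h4 : u (Equiv.swap a b c) < u (Equiv.swap a b d))
    (h5 : ∀ z, Equiv.swap p q (Equiv.swap r s z) = Equiv.swap a b (Equiv.swap c d z))
    (h6 : (∀ z, Equiv.swap r s z = Equiv.swap a b z) ∨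
      ∀ z, Equiv.swap r s z = Equiv.swap p q (Equiv.swap a b (Equiv.swap p q z))) :
    Dia u p q r s := by
  refine ⟨a, b, h1, h2, ⟨c, d, h3, h4, ?_⟩, ?_⟩
  · rw [mul_assoc, mul_assoc]
    congr 1
    ext1 z; exact h5 z
  · rcases h6 with h | h
    · left; ext1 z; exact h z
    · right; ext1 z; exact h z

lemma dia_triple {n : ℕ} (u : Equiv.Perm (Fin n)) (a b c : Fin n) (hab : a < b) (hbc : b < c) :
    (u a < u b → u a < u c → Dia u a b b c) ∧
    (u a < u b → u b < u c → Dia u a b a c) ∧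
    (u b < u c → u a < u c → Dia u b c a b) ∧
    (u b < u c → u a < u b → Dia u b c a c) ∧
    (u a < u c → u c < u b → Dia u a c a b) ∧
    (u a < u c → u b < u a → Dia u a c b c) := by
  have n1 := hab.ne
  have n2 := hbc.ne
  have n3 := (hab.trans hbc).ne
  have hac := hab.trans hbc
  have m1 : u a ≠ u b := fun h => n1 (u.injective h)
  have m2 : u b ≠ u c := fun h => n2 (u.injective h)
  refine ⟨?_, ?_, ?_, ?_, ?_, ?_⟩ <;> intro h1 h2
  · rcases lt_or_gt_of_ne m2 with h | h
    · apply dia_core u a b b c b c a c hbc h hac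
      all_goals (simp only [Equiv.swap_apply_def]; grind)
    · apply dia_core u a b b c a c a b hac h2 hab
      all_goals (simp only [Equiv.swap_apply_def]; grind)
  · apply dia_core u a b a c b c a b hbc h2 hab
    all_goals (simp only [Equiv.swap_apply_def]; grind)
  · rcases lt_or_gt_of_ne m1 with h | h
    · apply dia_core u b c a b a b a c hab h hac
      all_goals (simp only [Equiv.swap_apply_def]; grind)
    · apply dia_core u b c a b a c b c hac h2 hbc
      all_goals (simp only [Equiv.swap_apply_def]; grind)
  · apply dia_core u b c a c a b b c hab h2 hbc
    all_goals (simp only [Equiv.swap_apply_def]; grind)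
  · apply dia_core u a c a b a b b c hab (h1.trans h2) hbc
    all_goals (simp only [Equiv.swap_apply_def]; grind)
  · apply dia_core u a c b c b c a b hbc (h2.trans h1) hab
    all_goals (simp only [Equiv.swap_apply_def]; grind)

lemma diamond {n : ℕ} (u : Equiv.Perm (Fin n)) (p q r s : Fin n) (hpq : p < q) (h1 : u p < u q)
    (hrs : r < s) (h2 : u (Equiv.swap p q r) < u (Equiv.swap p q s)) : Dia u p q r s := by
  have npq := hpq.ne
  have nrs := hrs.ne
  by_cases e1 : p = r
  · subst e1
    by_cases e2 : q = s
    · subst e2; simp at h2; exact absurd h1 (not_lt.2 h2.le)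
    · rw [Equiv.swap_apply_left, Equiv.swap_apply_of_ne_of_ne (by grind) (by grind)] at h2
      rcases lt_or_gt_of_ne e2 with h | h
      · exact (dia_triple u p q s hpq h).2.1 h1 h2
      · exact (dia_triple u p s q hrs h).2.2.2.2.1 h1 h2
  · by_cases e2 : q = s
    · subst e2
      rw [Equiv.swap_apply_right, Equiv.swap_apply_of_ne_of_ne (by grind) (by grind)] at h2
      rcases lt_or_gt_of_ne e1 with h | h
      · exact (dia_triple u p r q h hrs).2.2.2.2.2 h1 h2
      · exact (dia_triple u r p q h hpq).2.2.2.1 h1 h2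
    · by_cases e3 : p = s
      · subst e3
        rw [Equiv.swap_apply_left, Equiv.swap_apply_of_ne_of_ne (by grind) (by grind)] at h2
        exact (dia_triple u r p q hrs hpq).2.2.1 h1 h2
      · by_cases e4 : q = r
        · subst e4
          rw [Equiv.swap_apply_right, Equiv.swap_apply_of_ne_of_ne (by grind) (by grind)] at h2
          exact (dia_triple u p q s hpq hrs).1 h1 h2
        · rw [Equiv.swap_apply_of_ne_of_ne (by grind) (by grind),
            Equiv.swap_apply_of_ne_of_ne (by grind) (by grind)] at h2
          apply dia_core u p q r s r s p q hrs h2 hpq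
          · rwa [Equiv.swap_apply_of_ne_of_ne (by grind) (by grind),
              Equiv.swap_apply_of_ne_of_ne (by grind) (by grind)]
          · intro z; simp only [Equiv.swap_apply_def]; grind
          · left; intro z; rfl

lemma cover_of_box {n : ℕ} (x : Equiv.Perm (Fin n)) (p q : Fin n) (hpq : p < q) (hx : x p < x q)
    (hbox : ∀ r, p < r → r < q → x p < x r → x r < x q → False) (z : Equiv.Perm (Fin n))
    (h1 : GLE x z) (h2 : GLE z (x * Equiv.swap p q)) : z = x ∨ z = x * Equiv.swap p q := by
  obtain ⟨m0, hm0⟩ := exists_reduced 2 (w0 2)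
  have hlen : m0.length ≤ 1 := hm0.2.2 [1] (by simp [IsWordA]) (by decide)
  have hr : ∀ r, r ∉ Set.range ![p, q] → r ≠ p ∧ r ≠ q := by
    intro r hr
    exact ⟨fun h => hr ⟨0, by simp [h]⟩, fun h => hr ⟨1, by simp [h]⟩⟩
  obtain ⟨pre, post, M, hA, hB⟩ := factor (m := 1) m0 hm0 _ x (x * Equiv.swap p q) ![p, q] rfl
    (by intro i j hij; fin_cases i <;> fin_cases j <;> simp_all)
    (by intro i j hij; fin_cases i <;> fin_cases j <;> simp_all)
    (by intro i; fin_cases i <;> simp)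
    (by
      intro r h
      have := hr r h
      simp [Equiv.swap_apply_of_ne_of_ne this.1 this.2])
    (by
      intro r h a b c d
      exact hbox r (by simpa using a) (by simpa using b) (by simpa using c) (by simpa using d))
  have lA := (reducedA_iff.1 hA).2.2
  have lB := (reducedA_iff.1 hB).2.2
  simp [shift] at lA lB
  by_contra hcon
  push Not at hcon
  have l1 := h1.lenA_lt (Ne.symm hcon.1)
  have l2 := h2.lenA_lt hcon.2
  omega

lemma label_mem₁ {n : ℕ} (x y : Equiv.Perm (Fin n)) (W : Subgroup (Equiv.Perm (Fin n)))
    (hW : ∀ p q, p < q → x p < x q → GLE (x * Equiv.swap p q) y →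
      (∀ z, GLE x z → GLE z (x * Equiv.swap p q) → z = x ∨ z = x * Equiv.swap p q) →
      Equiv.swap p q ∈ W) (l : ℕ) :
    ∀ p q, lenA n (x * Equiv.swap p q) = l → p < q → x p < x q → GLE (x * Equiv.swap p q) y →
      Equiv.swap p q ∈ W := by
  induction l using Nat.strong_induction_on with
  | _ l ih =>
  intro p q hl hpq hx hy
  by_cases hb : ∃ r, p < r ∧ r < q ∧ x p < x r ∧ x r < x q
  · obtain ⟨r, r1, r2, r3, r4⟩ := hb
    obtain ⟨⟨z, z1, z2⟩, ⟨z', z1', z2'⟩⟩ := box_edges x p r q r1 r2 r3 r4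
    have m1 := ih _ (by rw [← hl]; exact z1.lenA_lt.trans z2.lenA_lt) p r rfl r1 r3
      ((z1.gle.trans z2.gle).trans hy)
    have m2 := ih _ (by rw [← hl]; exact z1'.lenA_lt.trans z2'.lenA_lt) r q rfl r2 r4
      ((z1'.gle.trans z2'.gle).trans hy)
    have : Equiv.swap p q = Equiv.swap p r * Equiv.swap r q * Equiv.swap p r := by
      have n1 := r1.ne
      have n2 := r2.ne
      have n3 := (r1.trans r2).ne
      ext1 z; simp only [Equiv.Perm.mul_apply, Equiv.swap_apply_def]; grind
    rw [this]
    exact W.mul_mem (W.mul_mem m1 m2) m1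
  · push Not at hb
    exact hW p q hpq hx hy (cover_of_box x p q hpq hx
      (fun r a b c d => absurd d (not_lt.2 (hb r a b c))))

lemma label_mem₂ {n : ℕ} (x y : Equiv.Perm (Fin n)) (W : Subgroup (Equiv.Perm (Fin n)))
    (hW : ∀ p q, p < q → x p < x q → GLE (x * Equiv.swap p q) y →
      (∀ z, GLE x z → GLE z (x * Equiv.swap p q) → z = x ∨ z = x * Equiv.swap p q) →
      Equiv.swap p q ∈ W) (l : ℕ) :
    ∀ u, lenA n u = l → GLE x u → ∀ p q, p < q → u p < u q → GLE (u * Equiv.swap p q) y →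
      Equiv.swap p q ∈ W := by
  induction l using Nat.strong_induction_on with
  | _ l ih =>
  intro u hl hxu r s hrs hu hy
  rcases Relation.ReflTransGen.cases_tail hxu with h | ⟨u', h1, h2⟩
  · subst h
    exact label_mem₁ _ y W hW _ r s rfl hrs hu hy
  · have hlt := h2.lenA_lt
    obtain ⟨p, q, hpq, hu', rfl⟩ := h2
    obtain ⟨a, b, hab, hab', hE, hD⟩ := diamond u' p q r s hpq hu' hrs hu
    have e2 : Edge (u' * Equiv.swap p q) (u' * Equiv.swap p q * Equiv.swap r s) :=
      ⟨r, s, hrs, hu, rfl⟩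
    have m1 := ih _ (by rw [← hl]; exact hlt) u' rfl h1 p q hpq hu' (e2.gle.trans hy)
    have m2 := ih _ (by rw [← hl]; exact hlt) u' rfl h1 a b hab hab' (hE.gle.trans hy)
    rcases hD with h | h
    · rw [h]; exact m2
    · rw [h]; exact W.mul_mem (W.mul_mem m1 m2) m1

lemma interval_mem {n : ℕ} (x y : Equiv.Perm (Fin n)) (W : Subgroup (Equiv.Perm (Fin n)))
    (hW : ∀ p q, p < q → x p < x q → GLE (x * Equiv.swap p q) y →
      (∀ z, GLE x z → GLE z (x * Equiv.swap p q) → z = x ∨ z = x * Equiv.swap p q) →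
      Equiv.swap p q ∈ W) (z : Equiv.Perm (Fin n)) (h1 : GLE x z) (h2 : GLE z y) :
    x⁻¹ * z ∈ W := by
  induction h1 with
  | refl => simp
  | tail h h' ih =>
    have := ih (h'.gle.trans h2)
    obtain ⟨p, q, hpq, hb, rfl⟩ := h'
    rw [← mul_assoc]
    exact W.mul_mem this (label_mem₂ x y W hW _ _ rfl h p q hpq hb h2)

lemma strictMono_perm_eq {k : ℕ} (g : Equiv.Perm (Fin k)) (hg : StrictMono g) : ∀ i, g i = i := by
  have := (StrictMono.range_inj hg (strictMono_id (α := Fin k))).1 (by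
    rw [g.surjective.range_eq, Set.range_id])
  intro i; rw [this]; rfl

lemma gle_w0 (k : ℕ) (v : Equiv.Perm (Fin k)) : GLE v (w0 k) := by
  classical
  have : Nonempty {u : Equiv.Perm (Fin k) // GLE v u} := ⟨⟨v, GLE.refl v⟩⟩
  obtain ⟨⟨u, hu⟩, hmax⟩ := Finite.exists_max
    (fun u : {u : Equiv.Perm (Fin k) // GLE v u} => lenA k u.1)
  have hanti : ∀ p q, p < q → u q < u p := by
    intro p q hpq
    by_contra hcon
    have hlt : u p < u q := lt_of_le_of_ne (not_lt.1 hcon) (fun h => hpq.ne (u.injective h))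
    have he : Edge u (u * Equiv.swap p q) := ⟨p, q, hpq, hlt, rfl⟩
    have := hmax ⟨_, hu.trans he.gle⟩
    exact absurd he.lenA_lt (not_lt.2 this)
  have hid := strictMono_perm_eq (u * Fin.revPerm) (by
    intro a b hab
    exact hanti _ _ (Fin.rev_lt_rev.2 hab))
  have : u = w0 k := by
    ext1 i
    have := hid i.rev
    simpa [w0] using this
  rw [← this]; exact hu

lemma one_gle {k : ℕ} (v : Equiv.Perm (Fin k)) : GLE 1 v := by
  obtain ⟨b, hb⟩ := exists_reduced k v
  have := gle_of_sublist b [] (List.nil_sublist _) (by rw [hb.2.1]; exact hb)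
  rwa [hb.2.1] at this

lemma exists_sA_gle {k : ℕ} (v : Equiv.Perm (Fin k)) (hv : v ≠ 1) :
    ∃ i, 1 ≤ i ∧ i < k ∧ GLE (sA k i) v := by
  obtain ⟨b, hb⟩ := exists_reduced k v
  cases b with
  | nil => exact absurd hb.2.1.symm hv
  | cons i b =>
    have := gle_of_sublist (i :: b) [i] (by simp) (by rw [hb.2.1]; exact hb)
    rw [hb.2.1, prodA_singleton] at this
    have hi := hb.1 i (by simp)
    exact ⟨i, hi.1, by omega, this⟩

lemma sA_ne_one {k i : ℕ} (h1 : 1 ≤ i) (h2 : i < k) : sA k i ≠ 1 := by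
  rw [sA_eq h1 h2]
  intro h
  rw [Equiv.swap_eq_one_iff] at h
  simp [Fin.ext_iff] at h
  omega

lemma sA_inj {k i j : ℕ} (h1 : 1 ≤ i) (h2 : i < k) (h3 : 1 ≤ j) (h4 : j < k)
    (h : sA k i = sA k j) : i = j := by
  rw [sA_eq h1 h2, sA_eq h3 h4] at h
  have e1 := congrArg (fun g => (g ⟨i, h2⟩).val) h
  have e2 := congrArg (fun g => (g ⟨i - 1, by omega⟩).val) h
  simp only [Equiv.swap_apply_def, Fin.ext_iff] at e1 e2
  split_ifs at e1 e2 <;> simp at * <;> omega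

lemma mem_of_sA_gle {k l : ℕ} (h1 : 1 ≤ l) (h2 : l < k) (w : List ℕ) (hw : IsWordA k w)
    (h : GLE (sA k l) (prodA k w)) : l ∈ w := by
  obtain ⟨w', a, b⟩ := h.exists_sublist w hw rfl
  have hlen := b.2.2 [l] (isWordA_singleton.2 ⟨h1, h2⟩) (prodA_singleton _ _)
  match w', a, b, hlen with
  | [], a, b, _ => exact absurd b.2.1.symm (sA_ne_one h1 h2)
  | [i], a, b, _ =>
    have e := b.2.1
    rw [prodA_singleton] at e
    have hi := isWordA_singleton.1 b.1
    have := sA_inj hi.1 hi.2 h1 h2 e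
    subst this
    exact a.subset (by simp)
  | i :: j :: t, a, b, hlen => simp at hlen

lemma gle_sA {k l : ℕ} (h1 : 1 ≤ l) (h2 : l < k) (z : Equiv.Perm (Fin k)) (h : GLE z (sA k l)) :
    z = 1 ∨ z = sA k l := by
  obtain ⟨w', a, b⟩ := h.exists_sublist [l] (isWordA_singleton.2 ⟨h1, h2⟩) (prodA_singleton _ _)
  rcases List.sublist_singleton.1 a with rfl | rfl
  · left; exact b.2.1.symm
  · right; rw [← b.2.1, prodA_singleton]

lemma klein {G : Type*} [Group G] (a b : G) (ha : a * a = 1) (hb : b * b = 1)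
    (hab : a * b = b * a) :
    ∃ W : Subgroup G, a ∈ W ∧ b ∈ W ∧ ∀ g ∈ W, g = 1 ∨ g = a ∨ g = b ∨ g = a * b := by
  have hc : Commute a b := hab
  have key : ∀ i j : ℕ, a ^ i * b ^ j = 1 ∨ a ^ i * b ^ j = a ∨ a ^ i * b ^ j = b ∨
      a ^ i * b ^ j = a * b := by
    have h2 : ∀ c : G, c * c = 1 → ∀ i : ℕ, c ^ i = 1 ∨ c ^ i = c := by
      intro c hc i
      induction i with
      | zero => left; simp
      | succ i ih => rw [pow_succ]; rcases ih with h | h <;> simp [h, hc]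
    intro i j
    rcases h2 a ha i with h | h <;> rcases h2 b hb j with h' | h' <;> simp [h, h']
  refine ⟨{ carrier := {g | ∃ i j : ℕ, g = a ^ i * b ^ j}, mul_mem' := ?_, one_mem' := ?_,
            inv_mem' := ?_ }, ?_, ?_, ?_⟩
  · rintro _ _ ⟨i, j, rfl⟩ ⟨i', j', rfl⟩
    refine ⟨i + i', j + j', ?_⟩
    have : b ^ j * a ^ i' = a ^ i' * b ^ j := ((hc.pow_pow i' j).eq).symm
    rw [pow_add, pow_add, mul_assoc, ← mul_assoc (b ^ j), this]
    simp [mul_assoc]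
  · exact ⟨0, 0, by simp⟩
  · rintro _ ⟨i, j, rfl⟩
    refine ⟨i, j, ?_⟩
    have ha' : a⁻¹ = a := inv_eq_of_mul_eq_one_left ha
    have hb' : b⁻¹ = b := inv_eq_of_mul_eq_one_left hb
    rw [mul_inv_rev, ← inv_pow, ← inv_pow, ha', hb']
    exact ((hc.pow_pow i j).eq).symm
  · exact ⟨1, 0, by simp⟩
  · exact ⟨0, 1, by simp⟩
  · rintro _ ⟨i, j, rfl⟩
    exact key i j

def fixOut {n : ℕ} (S : Finset (Fin n)) : Subgroup (Equiv.Perm (Fin n)) where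
  carrier := {g | ∀ a, ¬ a ∈ S → g a = a}
  mul_mem' := by
    intro a b ha hb q hq
    rw [Equiv.Perm.mul_apply, hb q hq, ha q hq]
  one_mem' := by intro q _; rfl
  inv_mem' := by
    intro a ha q hq
    rw [Equiv.Perm.inv_eq_iff_eq]
    exact (ha q hq).symm

lemma mem_fixOut {n : ℕ} {S : Finset (Fin n)} {g : Equiv.Perm (Fin n)} :
    g ∈ fixOut S ↔ ∀ a, ¬ a ∈ S → g a = a := Iff.rfl

lemma swap_mem_fixOut {n : ℕ} {S : Finset (Fin n)} {p q : Fin n} (hp : p ∈ S) (hq : q ∈ S) :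
    Equiv.swap p q ∈ fixOut S := by
  intro a ha
  exact Equiv.swap_apply_of_ne_of_ne (fun h => ha (h ▸ hp)) (fun h => ha (h ▸ hq))

lemma card_fixOut {n : ℕ} (S : Finset (Fin n)) : Nat.card (fixOut S) = S.card.factorial := by
  have e := Equiv.Perm.subtypeEquivSubtypePerm (fun a => a ∈ S)
  have h1 : Nat.card (fixOut S) = Nat.card { f : Equiv.Perm (Fin n) // ∀ a, ¬ a ∈ S → f a = a } := rfl
  rw [h1, ← Nat.card_congr e, Nat.card_eq_fintype_card, Fintype.card_perm, Fintype.card_coe]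

lemma chain_card {n m : ℕ} (P Q : Fin (m + 1) → Fin n)
    (hsh : ∀ (j : ℕ) (h : j + 1 < m + 1),
      P ⟨j + 1, h⟩ = P ⟨j, by omega⟩ ∨ P ⟨j + 1, h⟩ = Q ⟨j, by omega⟩ ∨
      Q ⟨j + 1, h⟩ = P ⟨j, by omega⟩ ∨ Q ⟨j + 1, h⟩ = Q ⟨j, by omega⟩) :
    (Finset.univ.biUnion (fun j => ({P j, Q j} : Finset (Fin n)))).card ≤ m + 2 := by
  classical
  have key : ∀ t, t < m + 1 → ∃ T : Finset (Fin n), T.card ≤ t + 2 ∧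
      ∀ j : Fin (m + 1), j.val ≤ t → P j ∈ T ∧ Q j ∈ T := by
    intro t
    induction t with
    | zero =>
      intro _
      refine ⟨{P 0, Q 0}, Finset.card_le_two, ?_⟩
      intro j hj
      have : j = 0 := Fin.ext (by simpa using hj)
      subst this
      simp
    | succ t ih =>
      intro ht
      obtain ⟨T, hT, hT'⟩ := ih (by omega)
      have hold := hT' ⟨t, by omega⟩ le_rfl
      have hnew : ∃ r, P ⟨t + 1, ht⟩ ∈ insert r T ∧ Q ⟨t + 1, ht⟩ ∈ insert r T := by
        rcases hsh t ht with h | h | h | h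
        · exact ⟨Q ⟨t + 1, ht⟩, by rw [h]; simp [hold], by simp⟩
        · exact ⟨Q ⟨t + 1, ht⟩, by rw [h]; simp [hold], by simp⟩
        · exact ⟨P ⟨t + 1, ht⟩, by simp, by rw [h]; simp [hold]⟩
        · exact ⟨P ⟨t + 1, ht⟩, by simp, by rw [h]; simp [hold]⟩
      obtain ⟨r, h1, h2⟩ := hnew
      refine ⟨insert r T, (Finset.card_insert_le _ _).trans (by omega), ?_⟩
      intro j hj
      rcases Nat.lt_or_ge j.val (t + 1) with h | h
      · have := hT' j (by omega)
        exact ⟨Finset.mem_insert_of_mem this.1, Finset.mem_insert_of_mem this.2⟩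
      · have : j = ⟨t + 1, ht⟩ := Fin.ext (by simp; omega)
        subst this
        exact ⟨h1, h2⟩
  obtain ⟨T, h1, h2⟩ := key m (by omega)
  refine (Finset.card_le_card ?_).trans h1
  intro q hq
  simp only [Finset.mem_biUnion, Finset.mem_univ, true_and, Finset.mem_insert,
    Finset.mem_singleton] at hq
  obtain ⟨j, rfl | rfl⟩ := hq
  · exact (h2 j (by omega)).1
  · exact (h2 j (by omega)).2

/-- The interval is a full coset of a symmetric group on `m+2` positions. -/
lemma interval_coset {n m : ℕ} (x y : Equiv.Perm (Fin n))
    (φ : Equiv.Perm (Fin (m + 2)) → Equiv.Perm (Fin n))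
    (hφ : ∀ u v, GLE (φ u) (φ v) ↔ GLE u v) (hφx : ∀ v, GLE x (φ v)) (hφy : ∀ v, GLE (φ v) y)
    (hsurj : ∀ z, GLE x z → GLE z y → ∃ v, φ v = z) (hxy : GLE x y) :
    ∃ S : Finset (Fin n), S.card = m + 2 ∧
      ∀ g, g ∈ fixOut S ↔ (GLE x (x * g) ∧ GLE (x * g) y) := by
  classical
  have hinj : Function.Injective φ := by
    intro u v h
    exact GLE.antisymm ((hφ u v).1 (by rw [h]; exact GLE.refl _))
      ((hφ v u).1 (by rw [h]; exact GLE.refl _))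
  have hφ1 : φ 1 = x := by
    obtain ⟨v, hv⟩ := hsurj x (GLE.refl x) hxy
    apply GLE.antisymm _ (hφx 1)
    rw [← hv]
    exact (hφ _ _).2 (one_gle v)
  have hatom : ∀ j : Fin (m + 1), ∃ p q, p < q ∧ φ (sA (m + 2) (j.val + 1)) = x * Equiv.swap p q := by
    intro j
    have hj1 : 1 ≤ j.val + 1 := by omega
    have hj2 : j.val + 1 < m + 2 := by omega
    rcases Relation.ReflTransGen.cases_head (hφx (sA (m + 2) (j.val + 1))) with h | ⟨c, hc1, hc2⟩
    · rw [← hφ1] at h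
      exact absurd (hinj h).symm (sA_ne_one hj1 hj2)
    · obtain ⟨v, rfl⟩ := hsurj c hc1.gle (GLE.trans hc2 (hφy _))
      have hv := (hφ _ _).1 hc2
      rcases gle_sA hj1 hj2 v hv with rfl | rfl
      · rw [hφ1] at hc1
        exact absurd hc1.lenA_lt (lt_irrefl _)
      · obtain ⟨p, q, hpq, _, he⟩ := hc1
        exact ⟨p, q, hpq, he⟩
  choose P Q hPQ hφs using hatom
  have hgen : ∀ (w : List ℕ) (_ : IsWordA (m + 2) w) (W : Subgroup (Equiv.Perm (Fin n)))
      (_ : ∀ j : Fin (m + 1), j.val + 1 ∈ w → Equiv.swap (P j) (Q j) ∈ W)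
      (v : Equiv.Perm (Fin (m + 2))) (_ : GLE v (prodA (m + 2) w)), x⁻¹ * φ v ∈ W := by
    intro w hw W hW v hv
    apply interval_mem x (φ (prodA (m + 2) w)) W _ _ (hφx v) ((hφ _ _).2 hv)
    intro p q hpq hx hle hcov
    have hE : Edge x (x * Equiv.swap p q) := ⟨p, q, hpq, hx, rfl⟩
    obtain ⟨u, hu⟩ := hsurj _ hE.gle (hle.trans (hφy _))
    have hu1 : u ≠ 1 := by
      rintro rfl
      rw [hφ1] at hu
      rw [← hu] at hE
      exact absurd hE.lenA_lt (lt_irrefl _)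
    obtain ⟨i, hi1, hi2, hi3⟩ := exists_sA_gle u hu1
    have hiw : i ∈ w := by
      apply mem_of_sA_gle hi1 hi2 w hw
      rw [← hu] at hle
      exact hi3.trans ((hφ _ _).1 hle)
    have hsi := hφs ⟨i - 1, by omega⟩
    have hi' : i - 1 + 1 = i := by omega
    simp only [hi'] at hsi
    have := hcov (φ (sA (m + 2) i)) (hφx _) (by rw [← hu]; exact (hφ _ _).2 hi3)
    rcases this with h | h
    · rw [← hφ1] at h
      exact absurd (hinj h) (sA_ne_one hi1 hi2)
    · rw [h] at hsi
      rw [mul_left_cancel hsi]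
      exact hW _ (by simpa [hi'] using hiw)
  have hshare : ∀ (j : ℕ) (h : j + 1 < m + 1),
      P ⟨j + 1, h⟩ = P ⟨j, by omega⟩ ∨ P ⟨j + 1, h⟩ = Q ⟨j, by omega⟩ ∨
      Q ⟨j + 1, h⟩ = P ⟨j, by omega⟩ ∨ Q ⟨j + 1, h⟩ = Q ⟨j, by omega⟩ := by
    intro j h
    by_contra hcon
    push Not at hcon
    obtain ⟨c1, c2, c3, c4⟩ := hcon
    set t := Equiv.swap (P ⟨j, by omega⟩) (Q ⟨j, by omega⟩) with ht
    set t' := Equiv.swap (P ⟨j + 1, h⟩) (Q ⟨j + 1, h⟩) with ht'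
    have hcomm : t * t' = t' * t := by
      ext1 z
      simp only [ht, ht', Equiv.Perm.mul_apply, Equiv.swap_apply_def]
      grind
    obtain ⟨W, w1, w2, w3⟩ := klein t t' (by simp [ht]) (by simp [ht']) hcomm
    set s := sA (m + 2) (j + 1) with hs
    set s' := sA (m + 2) (j + 2) with hs'
    have es : φ s = x * t := hφs ⟨j, by omega⟩
    have es' : φ s' = x * t' := hφs ⟨j + 1, h⟩
    have ns : s ≠ 1 := sA_ne_one (by omega) (by omega)
    have ns' : s' ≠ 1 := sA_ne_one (by omega) (by omega)
    have nss : s ≠ s' := fun he => by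
      have := sA_inj (by omega) (by omega) (by omega) (by omega) he
      omega
    have ss : s * s = 1 := sA_mul_self _ _
    have ss' : s' * s' = 1 := sA_mul_self _ _
    have hmem : ∀ w : List ℕ, (w = [j + 1, j + 2] ∨ w = [j + 2, j + 1]) →
        x⁻¹ * φ (prodA (m + 2) w) ∈ W := by
      intro w hw
      refine hgen w ?_ W ?_ _ (GLE.refl _)
      · intro i hi
        rcases hw with rfl | rfl <;> simp at hi <;> omega
      · intro i hi
        have : i = ⟨j, by omega⟩ ∨ i = ⟨j + 1, h⟩ := by
          simp only [Fin.ext_iff]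
          rcases hw with rfl | rfl <;> simp at hi <;> omega
        rcases this with rfl | rfl
        · exact w1
        · exact w2
    have fin : ∀ g : Equiv.Perm (Fin (m + 2)), x⁻¹ * φ g ∈ W → g ≠ 1 → g ≠ s → g ≠ s' →
        φ g = x * (t * t') := by
      intro g hg g1 g2 g3
      rcases w3 _ hg with e | e | e | e
      · rw [inv_mul_eq_iff_eq_mul, mul_one, ← hφ1] at e
        exact absurd (hinj e) g1
      · rw [inv_mul_eq_iff_eq_mul, ← es] at e
        exact absurd (hinj e) g2
      · rw [inv_mul_eq_iff_eq_mul, ← es'] at e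
        exact absurd (hinj e) g3
      · rwa [inv_mul_eq_iff_eq_mul] at e
    have p1 : prodA (m + 2) [j + 1, j + 2] = s * s' := by simp [prodA, hs, hs']
    have p2 : prodA (m + 2) [j + 2, j + 1] = s' * s := by simp [prodA, hs, hs']
    have q1 := fin (s * s') (by rw [← p1]; exact hmem _ (Or.inl rfl))
      (fun e => nss (by rw [← ss'] at e; exact mul_right_cancel e))
      (fun e => ns' (by simpa using e)) (fun e => ns (by simpa using e))
    have q2 := fin (s' * s) (by rw [← p2]; exact hmem _ (Or.inr rfl))
      (fun e => nss (by rw [← ss] at e; exact (mul_right_cancel e).symm))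
      (fun e => ns' (by simpa using e)) (fun e => ns (by simpa using e))
    have heq := hinj (q1.trans q2.symm)
    rw [hs, hs', sA_eq (by omega) (by omega), sA_eq (by omega) (by omega)] at heq
    have := congrArg (fun g => (g ⟨j, by omega⟩).val) heq
    simp [Equiv.swap_apply_def] at this
  let S := Finset.univ.biUnion (fun j => ({P j, Q j} : Finset (Fin n)))
  have hScard : S.card ≤ m + 2 := chain_card P Q hshare
  have hmemS : ∀ v, x⁻¹ * φ v ∈ fixOut S := by
    obtain ⟨w, hw⟩ := exists_reduced (m + 2) (w0 (m + 2))
    intro v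
    refine hgen w hw.1 (fixOut S) ?_ v (by rw [hw.2.1]; exact gle_w0 _ v)
    intro j _
    apply swap_mem_fixOut
    · exact Finset.mem_biUnion.2 ⟨j, Finset.mem_univ _, by simp⟩
    · exact Finset.mem_biUnion.2 ⟨j, Finset.mem_univ _, by simp⟩
  let F : Equiv.Perm (Fin (m + 2)) → fixOut S := fun v => ⟨x⁻¹ * φ v, hmemS v⟩
  have hF : Function.Injective F := by
    intro u v h
    have := congrArg Subtype.val h
    exact hinj (mul_left_cancel this)
  have hcard : Nat.card (Equiv.Perm (Fin (m + 2))) = (m + 2).factorial := by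
    rw [Nat.card_eq_fintype_card, Fintype.card_perm, Fintype.card_fin]
  have hle := Nat.card_le_card_of_injective F hF
  rw [hcard, card_fixOut] at hle
  have hS : S.card = m + 2 := by
    by_contra hne
    have h1 : S.card ≤ m + 1 := by omega
    have h2 := Nat.factorial_le h1
    have h3 : (m + 1).factorial < (m + 2).factorial := (Nat.factorial_lt (by omega)).2 (by omega)
    omega
  have hFs : Function.Surjective F :=
    (Function.Injective.bijective_of_nat_card_le hF (by rw [hcard, card_fixOut, hS])).2
  refine ⟨S, hS, ?_⟩
  intro g
  constructor
  · intro hg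
    obtain ⟨v, hv⟩ := hFs ⟨g, hg⟩
    have : x⁻¹ * φ v = g := congrArg Subtype.val hv
    rw [inv_mul_eq_iff_eq_mul] at this
    rw [← this]
    exact ⟨hφx v, hφy v⟩
  · rintro ⟨h1, h2⟩
    obtain ⟨v, hv⟩ := hsurj _ h1 h2
    have := hmemS v
    rw [hv] at this
    simpa using this

lemma main_aux {n m : ℕ} (x y : Equiv.Perm (Fin n))
    (φ : Equiv.Perm (Fin (m + 2)) → Equiv.Perm (Fin n))
    (hφ : ∀ u v, GLE (φ u) (φ v) ↔ GLE u v) (hφx : ∀ v, GLE x (φ v)) (hφy : ∀ v, GLE (φ v) y)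
    (hsurj : ∀ z, GLE x z → GLE z y → ∃ v, φ v = z) (hxy : GLE x y)
    (m0 : List ℕ) (hm0 : ReducedA (m + 2) m0 (w0 (m + 2))) :
    ∃ (pre post : List ℕ) (M : ℕ), ReducedA n (pre ++ shift M m0 ++ post) y ∧
      ReducedA n (pre ++ post) x := by
  classical
  obtain ⟨S, hS, hI⟩ := interval_coset x y φ hφ hφx hφy hsurj hxy
  have hxinc : ∀ p ∈ S, ∀ q ∈ S, p < q → x p < x q := by
    intro p hp q hq hpq
    by_contra hcon
    have hlt : x q < x p := lt_of_le_of_ne (not_lt.1 hcon) (fun h => hpq.ne' (x.injective h))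
    have h1 := ((hI _).1 (swap_mem_fixOut hp hq)).1
    have he : Edge (x * Equiv.swap p q) x := ⟨p, q, hpq, by simpa using hlt, by simp [mul_assoc]⟩
    exact absurd he.lenA_lt (not_lt.2 h1.lenA_le)
  have hmemy : x⁻¹ * y ∈ fixOut S := (hI _).2 (by simpa using ⟨hxy, GLE.refl y⟩)
  have hydec : ∀ p ∈ S, ∀ q ∈ S, p < q → y q < y p := by
    intro p hp q hq hpq
    by_contra hcon
    have hlt : y p < y q := lt_of_le_of_ne (not_lt.1 hcon) (fun h => hpq.ne (y.injective h))
    have h1 := ((hI _).1 ((fixOut S).mul_mem hmemy (swap_mem_fixOut hp hq))).2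
    rw [← mul_assoc, mul_inv_cancel_left] at h1
    have he : Edge y (y * Equiv.swap p q) := ⟨p, q, hpq, hlt, rfl⟩
    exact absurd he.lenA_lt (not_lt.2 h1.lenA_le)
  let f := S.orderEmbOfFin hS
  have hfS : ∀ i, f i ∈ S := fun i => S.orderEmbOfFin_mem hS i
  have hrange : Set.range f = (S : Set (Fin n)) := S.range_orderEmbOfFin hS
  have hyoff : ∀ q, q ∉ Set.range f → y q = x q := by
    intro q hq
    rw [hrange] at hq
    have := hmemy q (by simpa using hq)
    rw [Equiv.Perm.mul_apply, Equiv.Perm.inv_eq_iff_eq] at this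
    exact this
  have hyf : ∀ i, y (f i) = x (f i.rev) := by
    have e : (fun i => y (f (Fin.rev i))) = fun i => x (f i) := by
      apply (StrictMono.range_inj (β := Fin (m + 2)) (γ := Fin n) _ _).1
      · have hs : ∀ z, z ∈ S → x⁻¹ (y z) ∈ S := by
          intro z hz
          by_contra hcon
          have := hmemy _ hcon
          have h2 := (x⁻¹ * y).injective this
          exact hcon (by rw [h2]; exact hz)
        apply Set.eq_of_subset_of_ncard_le
        · rintro _ ⟨i, rfl⟩
          have h1 := hs _ (hfS i.rev)
          have h2 : x⁻¹ (y (f i.rev)) ∈ Set.range f := by rw [hrange]; exact h1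
          obtain ⟨j, hj⟩ := h2
          exact ⟨j, by simp [hj]⟩
        · rw [← Set.image_univ, ← Set.image_univ, Set.ncard_image_of_injective,
            Set.ncard_image_of_injective]
          · exact y.injective.comp (f.injective.comp Fin.rev_injective)
          · exact x.injective.comp f.injective
        · exact Set.toFinite _
      · intro a b hab
        exact hydec _ (hfS _) _ (hfS _) (f.strictMono (Fin.rev_lt_rev.2 hab))
      · intro a b hab
        exact hxinc _ (hfS _) _ (hfS _) (f.strictMono hab)
    intro i
    have := congrFun e i.rev
    simpa using this
  refine factor (m := m + 1) m0 hm0 _ x y f rfl f.strictMono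
    (fun i j hij => hxinc _ (hfS _) _ (hfS _) (f.strictMono hij)) hyf hyoff ?_
  intro q hq q1 q2 q3 q4
  rw [hrange] at hq
  obtain ⟨⟨z, z1, z2⟩, _⟩ := box_edges x _ q _ q1 q2 q3 q4
  have hE : Edge x (x * Equiv.swap (f 0) q) := ⟨_, _, q1, q3, rfl⟩
  have htop := ((hI _).1 (swap_mem_fixOut (hfS 0) (hfS (Fin.last _)))).2
  have hmem := (hI _).2 ⟨hE.gle, (z1.gle.trans z2.gle).trans htop⟩
  have := hmem q (by simpa using hq)
  rw [Equiv.swap_apply_right] at this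
  exact q1.ne this

theorem stmt8 (n k : ℕ) (x y : Equiv.Perm (Fin n)) (hxy : bruhatA n x y)
    (h : ∃ e : {z : Equiv.Perm (Fin n) // bruhatA n x z ∧ bruhatA n z y} ≃
          {v : Equiv.Perm (Fin k) // bruhatA k v (w0 k)},
        ∀ a b : {z : Equiv.Perm (Fin n) // bruhatA n x z ∧ bruhatA n z y},
          bruhatA n a.1 b.1 ↔ bruhatA k (e a).1 (e b).1) :
    ∃ (pre mid post : List ℕ) (M : ℕ) (m0 : List ℕ),
      ReducedA k m0 (w0 k) ∧ mid = shift M m0 ∧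
      ReducedA n (pre ++ mid ++ post) y ∧ ReducedA n (pre ++ post) x := by
  obtain ⟨e, he⟩ := h
  have hxx : bruhatA n x x := bruhatA_iff.2 (GLE.refl x)
  have hyy : bruhatA n y y := bruhatA_iff.2 (GLE.refl y)
  rcases Nat.lt_or_ge k 2 with hk | hk
  · have : Subsingleton (Fin k) := ⟨fun a b => Fin.ext (by omega)⟩
    have : Subsingleton (Equiv.Perm (Fin k)) := ⟨fun a b => by
      ext1 i; exact Subsingleton.elim _ _⟩
    have hsub : (⟨x, hxx, hxy⟩ : {z // bruhatA n x z ∧ bruhatA n z y}) = ⟨y, hxy, hyy⟩ :=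
      e.injective (Subtype.ext (Subsingleton.elim _ _))
    have hxy' : x = y := congrArg Subtype.val hsub
    obtain ⟨pre, hpre⟩ := exists_reduced n x
    refine ⟨pre, [], [], 0, [], ⟨by simp [IsWordA], Subsingleton.elim _ _, by simp⟩, rfl, ?_, ?_⟩
    · simpa [hxy'] using hxy' ▸ hpre
    · simpa using hpre
  · obtain ⟨m, rfl⟩ := Nat.exists_eq_add_of_le' hk
    obtain ⟨m0, hm0⟩ := exists_reduced (m + 2) (w0 (m + 2))
    let ι : Equiv.Perm (Fin (m + 2)) → {v : Equiv.Perm (Fin (m + 2)) // bruhatA (m + 2) v (w0 (m + 2))} :=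
      fun v => ⟨v, bruhatA_iff.2 (gle_w0 _ v)⟩
    obtain ⟨pre, post, M, hA, hB⟩ := main_aux x y (fun v => (e.symm (ι v)).1)
      (by
        intro u v
        rw [← bruhatA_iff, ← bruhatA_iff, he]
        simp [ι])
      (fun v => bruhatA_iff.1 (e.symm (ι v)).2.1)
      (fun v => bruhatA_iff.1 (e.symm (ι v)).2.2)
      (by
        intro z h1 h2
        refine ⟨(e ⟨z, bruhatA_iff.2 h1, bruhatA_iff.2 h2⟩).1, ?_⟩
        simp [ι])
      (bruhatA_iff.1 hxy) m0 hm0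
    exact ⟨pre, shift M m0, post, M, m0, hm0, rfl, hA, hB⟩

end Paper
end

section
/- Let k ≥ 4, let j be a reduced decomposition of the decreasing permutation w_0^{(k)} = k(k−1)···21 ∈ S_k, and suppose that the concatenation j^{M_1} j^{M_2} ··· j^{M_r} of shifts of j (by nonnegative integers M_1,...,M_r) is a reduced decomposition of some permutation w ∈ S_n. Then M_1,...,M_r are pairwise distinct. -/
namespace Paper

/-- Simple transposition on `ℕ` (0-indexed positions `i-1`, `i`). -/
def sN (i : ℕ) : Equiv.Perm ℕ := Equiv.swap (i - 1) i

/-- Product of a word in the permutations of `ℕ`. -/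
def prodN (w : List ℕ) : Equiv.Perm ℕ := (w.map sN).prod

theorem prodN_nil : prodN [] = 1 := rfl

theorem prodN_cons (a : ℕ) (w : List ℕ) : prodN (a :: w) = sN a * prodN w := by
  simp [prodN]

theorem prodN_append (a b : List ℕ) : prodN (a ++ b) = prodN a * prodN b := by
  simp [prodN]

theorem sN_mul_self (i : ℕ) : sN i * sN i = 1 := by simp [sN]

theorem sN_inv (i : ℕ) : (sN i)⁻¹ = sN i := by simp [sN]

theorem prodN_reverse (w : List ℕ) : prodN w.reverse = (prodN w)⁻¹ := by
  induction w with
  | nil => simp [prodN]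
  | cons a w ih =>
    rw [List.reverse_cons, prodN_append, ih, prodN_cons, prodN_cons, prodN_nil, mul_inv_rev, sN_inv,
      mul_one]

theorem sA_val (n i : ℕ) (h : 1 ≤ i ∧ i ≤ n - 1) (x : Fin n) :
    ((sA n i x : Fin n) : ℕ) = sN i x := by
  have h' : 1 ≤ i ∧ i < n := by omega
  simp only [sA, dif_pos h', sN, Equiv.swap_apply_def, Fin.ext_iff]
  split_ifs <;> rfl

theorem prodA_val (n : ℕ) (w : List ℕ) (h : IsWordA n w) (x : Fin n) :
    ((prodA n w x : Fin n) : ℕ) = prodN w x := by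
  induction w with
  | nil => simp [prodA, prodN]
  | cons a w ih =>
    have ha := h a (by simp)
    have hw : IsWordA n w := fun i hi => h i (by simp [hi])
    have e : prodA n (a :: w) = sA n a * prodA n w := by simp [prodA]
    rw [e, prodN_cons, Equiv.Perm.mul_apply, Equiv.Perm.mul_apply, sA_val n a ha, ih hw]

theorem sN_shift (M i x : ℕ) (h : 1 ≤ i) : sN (i + M) (x + M) = sN i x + M := by
  simp only [sN, Equiv.swap_apply_def]
  split_ifs <;> omega

theorem prodN_shift (M : ℕ) (w : List ℕ) (h : ∀ i ∈ w, 1 ≤ i) (x : ℕ) :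
    prodN (shift M w) (x + M) = prodN w x + M := by
  induction w with
  | nil => simp [prodN, shift]
  | cons a w ih =>
    have e : shift M (a :: w) = (a + M) :: shift M w := rfl
    rw [e, prodN_cons, prodN_cons, Equiv.Perm.mul_apply, Equiv.Perm.mul_apply,
      ih (fun i hi => h i (by simp [hi])), sN_shift _ _ _ (h a (by simp))]

/-- Exchange condition. -/
theorem exch (q : ℕ) (hq : 1 ≤ q) (w : List ℕ) (h : prodN w q < prodN w (q - 1)) :
    ∃ w' : List ℕ, w'.Sublist w ∧ w'.length + 1 = w.length ∧ prodN w = prodN w' * sN q := by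
  induction w with
  | nil => simp [prodN] at h; omega
  | cons a w ih =>
    by_cases hlt : prodN w q < prodN w (q - 1)
    · obtain ⟨w', h1, h2, h3⟩ := ih hlt
      refine ⟨a :: w', h1.cons_cons a, by simp [h2], ?_⟩
      rw [prodN_cons, prodN_cons, h3, mul_assoc]
    · refine ⟨w, List.sublist_cons_self a w, by simp, ?_⟩
      have hne : prodN w q ≠ prodN w (q - 1) := by
        intro e
        have := (prodN w).injective e
        omega
      rw [prodN_cons] at h ⊢
      rw [Equiv.Perm.mul_apply, Equiv.Perm.mul_apply] at h
      have key : prodN w (q - 1) = a - 1 ∧ prodN w q = a := by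
        simp only [sN, Equiv.swap_apply_def] at h
        split_ifs at h <;> omega
      have := Equiv.mul_swap_eq_swap_mul (prodN w) (q - 1) q
      rw [key.1, key.2] at this
      exact this.symm

theorem exch_left (q : ℕ) (hq : 1 ≤ q) (w : List ℕ) (h : (prodN w)⁻¹ q < (prodN w)⁻¹ (q - 1)) :
    ∃ w' : List ℕ, w'.Sublist w ∧ w'.length + 1 = w.length ∧ prodN w = sN q * prodN w' := by
  rw [← prodN_reverse] at h
  obtain ⟨w', h1, h2, h3⟩ := exch q hq _ h
  refine ⟨w'.reverse, ?_, by simpa using h2, ?_⟩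
  · simpa using h1.reverse
  · rw [prodN_reverse] at h3 ⊢
    rw [← inv_inv (prodN w), h3, mul_inv_rev, sN_inv]

theorem prodN_fix (x : ℕ) (w : List ℕ) (h : ∀ l ∈ w, l ≠ x ∧ l - 1 ≠ x) : prodN w x = x := by
  induction w with
  | nil => simp [prodN]
  | cons a w ih =>
    rw [prodN_cons, Equiv.Perm.mul_apply, ih (fun l hl => h l (by simp [hl]))]
    have := h a (by simp)
    exact Equiv.swap_apply_of_ne_of_ne (fun e => this.2 e.symm) (fun e => this.1 e.symm)

theorem prodN_w0 (k : ℕ) (j : List ℕ) (hj : ReducedA k j (w0 k)) (x : ℕ) (hx : x < k) :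
    prodN j x = k - 1 - x := by
  have := prodA_val k j hj.1 ⟨x, hx⟩
  rw [hj.2.1] at this
  simp [w0, Fin.val_rev] at this
  omega

theorem core (n k : ℕ) (j : List ℕ) (hj : ReducedA k j (w0 k))
    (A mid C : List ℕ) (N N' q : ℕ) (w : Equiv.Perm (Fin n))
    (hw : ReducedA n (A ++ (shift N j ++ (mid ++ (shift N' j ++ C)))) w)
    (h1 : N + 1 ≤ q) (h2 : q + 1 ≤ N + k) (h3 : N' + 1 ≤ q) (h4 : q + 1 ≤ N' + k)
    (hmid : ∀ l ∈ mid, q + 1 < l ∨ l + 1 < q) : False := by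
  have hpos : ∀ i ∈ j, 1 ≤ i := fun i hi => (hj.1 i hi).1
  have val : ∀ M x, M ≤ x → x < M + k → prodN (shift M j) x = M + (k - 1 - (x - M)) := by
    intro M x hx hx'
    have := prodN_shift M j hpos (x - M)
    rw [Nat.sub_add_cancel hx, prodN_w0 k j hj _ (by omega)] at this
    omega
  have ival : ∀ M x, M ≤ x → x < M + k → (prodN (shift M j))⁻¹ x = M + (k - 1 - (x - M)) := by
    intro M x hx hx'
    rw [Equiv.Perm.inv_eq_iff_eq, val M _ (by omega) (by omega)]
    omega
  obtain ⟨a, ha1, ha2, ha3⟩ := exch q (by omega) (shift N j) (by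
    rw [val N q (by omega) (by omega), val N (q - 1) (by omega) (by omega)]; omega)
  obtain ⟨b, hb1, hb2, hb3⟩ := exch_left q (by omega) (shift N' j) (by
    rw [ival N' q (by omega) (by omega), ival N' (q - 1) (by omega) (by omega)]; omega)
  have hcomm : prodN mid * sN q = sN q * prodN mid := by
    have := Equiv.mul_swap_eq_swap_mul (prodN mid) (q - 1) q
    rw [prodN_fix q mid (fun l hl => by have := hmid l hl; omega),
      prodN_fix (q - 1) mid (fun l hl => by have := hmid l hl; omega)] at this
    exact this
  have hprod : prodN (A ++ (shift N j ++ (mid ++ (shift N' j ++ C)))) =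
      prodN (A ++ (a ++ (mid ++ (b ++ C)))) := by
    simp only [prodN_append]
    rw [ha3, hb3]
    congr 1
    rw [mul_assoc (prodN a), ← mul_assoc (sN q) (prodN mid), ← hcomm]
    congr 1
    rw [mul_assoc (prodN mid), mul_assoc (sN q) (prodN b), ← mul_assoc (sN q) (sN q), sN_mul_self,
      one_mul]
  have hsub : (A ++ (a ++ (mid ++ (b ++ C)))).Sublist
      (A ++ (shift N j ++ (mid ++ (shift N' j ++ C)))) :=
    (List.Sublist.refl A).append (ha1.append ((List.Sublist.refl mid).append
      (hb1.append (List.Sublist.refl C))))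
  have hword : IsWordA n (A ++ (a ++ (mid ++ (b ++ C)))) := fun i hi => hw.1 i (hsub.subset hi)
  have hlen := hw.2.2 _ hword (by
    rw [← hw.2.1]
    ext x
    rw [prodA_val n _ hword, prodA_val n _ hw.1, hprod])
  simp only [List.length_append] at hlen
  omega

theorem list_split (l : List ℕ) (s t : ℕ) (hst : s < t) (ht : t < l.length) :
    ∃ A mid C : List ℕ, l = A ++ (l[s] :: (mid ++ (l[t] :: C))) ∧
      ∀ x ∈ mid, ∃ u, ∃ hu : u < l.length, s < u ∧ u < t ∧ x = l[u] := by
  refine ⟨l.take s, (l.take t).drop (s + 1), l.drop (t + 1), ?_, ?_⟩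
  · have e1 : l[t] :: l.drop (t + 1) = l.drop t := (List.drop_eq_getElem_cons ht).symm
    rw [e1]
    have hs : s < (l.take t).length := by simp; omega
    have e2 : l[s] :: (l.take t).drop (s + 1) = (l.take t).drop s := by
      rw [List.drop_eq_getElem_cons hs]; simp
    rw [← List.cons_append, e2, ← List.append_assoc]
    have e3 : l.take s = (l.take t).take s := by rw [List.take_take]; congr 1; omega
    rw [e3, List.take_append_drop, List.take_append_drop]
  · intro x hx
    obtain ⟨i, hi, rfl⟩ := List.getElem_of_mem hx
    simp only [List.length_drop, List.length_take] at hi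
    exact ⟨s + 1 + i, by omega, by omega, by omega, by simp⟩

theorem core' (n k r : ℕ) (j : List ℕ) (hj : ReducedA k j (w0 k))
    (M : Fin r → ℕ) (w : Equiv.Perm (Fin n))
    (hw : ReducedA n (List.ofFn (fun i => shift (M i) j)).flatten w)
    (s t : Fin r) (hst : s < t) (q : ℕ)
    (h1 : M s + 1 ≤ q) (h2 : q + 1 ≤ M s + k) (h3 : M t + 1 ≤ q) (h4 : q + 1 ≤ M t + k) :
    ∃ u : Fin r, s < u ∧ u < t ∧ M u ≤ q ∧ q ≤ M u + k := by
  by_contra hcon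
  push Not at hcon
  obtain ⟨A, mid, C, hl, hm⟩ := list_split (List.ofFn M) s t hst (by simp)
  have e : (List.ofFn (fun i => shift (M i) j)) = (List.ofFn M).map (fun N => shift N j) := by
    rw [List.map_ofFn]; rfl
  rw [e, hl] at hw
  simp only [List.map_append, List.map_cons, List.flatten_append, List.flatten_cons,
    List.getElem_ofFn] at hw
  refine core n k j hj _ _ _ _ _ q w hw h1 h2 h3 h4 ?_
  intro l hl
  simp only [List.mem_flatten, List.mem_map] at hl
  obtain ⟨_, ⟨N, hN, rfl⟩, hl⟩ := hl
  obtain ⟨u, hu, hsu, hut, rfl⟩ := hm N hN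
  simp only [List.length_ofFn] at hu
  have hc := hcon ⟨u, hu⟩ hsu hut
  simp only [shift, List.mem_map, List.getElem_ofFn] at hl
  obtain ⟨i, hi, rfl⟩ := hl
  have := hj.1 i hi
  omega

theorem far (k r : ℕ) (hk : 4 ≤ k) (M : Fin r → ℕ)
    (H : ∀ s t : Fin r, s < t → ∀ q : ℕ, M s + 1 ≤ q → q + 1 ≤ M s + k → M t + 1 ≤ q →
      q + 1 ≤ M t + k → ∃ u : Fin r, s < u ∧ u < t ∧ M u ≤ q ∧ q ≤ M u + k) :
    ∀ m : ℕ, ∀ s t : Fin r, (t : ℕ) = m → s < t → M s + k ≤ M t + 1 ∨ M t + k ≤ M s + 1 := by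
  intro m
  induction m using Nat.strong_induction_on with
  | _ m ih =>
    intro s t htm hst
    have first : ∀ s : Fin r, s < t → M s + k ≤ M t + 2 ∨ M t + k ≤ M s + 2 := by
      intro s hst
      by_contra hcon
      push Not at hcon
      have hq : ∃ q, M s + 2 ≤ q ∧ q + 2 ≤ M s + k ∧ M t + 1 ≤ q ∧ q + 1 ≤ M t + k := by
        by_cases h : M t ≤ M s
        · exact ⟨M s + 2, by omega⟩
        · exact ⟨M t + 1, by omega⟩
      obtain ⟨q, hq⟩ := hq
      obtain ⟨u, hsu, hut, hu1, hu2⟩ := H s t hst q (by omega) (by omega) (by omega) (by omega)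
      have := ih u (by omega) s u rfl hsu
      omega
    have hf := first s hst
    by_contra hcon
    push Not at hcon
    rcases hf with hf | hf
    · obtain ⟨u, hsu, hut, hu1, hu2⟩ := H s t hst (M t + 1)
        (by omega) (by omega) (by omega) (by omega)
      have h1 := ih u (by omega) s u rfl hsu
      have h2 := first u hut
      omega
    · obtain ⟨u, hsu, hut, hu1, hu2⟩ := H s t hst (M s + 1)
        (by omega) (by omega) (by omega) (by omega)
      have h1 := ih u (by omega) s u rfl hsu
      have h2 := first u hut
      omega

theorem stmt9 (n k r : ℕ) (hk : 4 ≤ k) (j : List ℕ) (hj : ReducedA k j (w0 k))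
    (M : Fin r → ℕ) (w : Equiv.Perm (Fin n))
    (hw : ReducedA n (List.ofFn (fun i => shift (M i) j)).flatten w) :
    Function.Injective M := by
  have hfar := far k r hk M (fun s t hst q h1 h2 h3 h4 =>
    core' n k r j hj M w hw s t hst q h1 h2 h3 h4)
  intro s t hst
  rcases lt_trichotomy s t with h | h | h
  · have := hfar t s t rfl h
    omega
  · exact h
  · have := hfar s t s rfl h
    omega

end Paper
end
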